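/- Let p be a prime, q = p^s with s ≥ 1, and let G be a primitive divergent graph with |E(G)| = N and with a 3-valent vertex v whose incident edges are labelled 1, 2, 3 with other endpoints a, b, c respectively. Let H = G − v, and suppose q² divides [Ψ_G]_q. Then c₂^{(q)}(G) ≡ −[(α₄⋯α_N)^{q−1}](Ψ_H · Φ^{b,ac}_H)^{q−1} (mod p); that is, [Ψ_G]_q / q² is congruent modulo p to minus the coefficient of (α₄⋯α_N)^{q−1} in (Ψ_H · Φ^{b,ac}_H)^{q−1}, where α₄, …, α_N are the variables of the edges of H. -/

import Mathlib

open MvPolynomial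

/-- The number of points `x ∈ 𝔽_q^σ`, `q = p^s`, at which the integer polynomial `F`
vanishes (coefficients mapped into the field canonically). -/
noncomputable def pointCount {σ : Type} (p s : ℕ) [Fact p.Prime] (F : MvPolynomial σ ℤ) : ℕ :=
  Nat.card {x : σ → GaloisField p s // MvPolynomial.aeval x F = 0}

-- The Kirchhoff polynomial `Ψ_G = ∑_T ∏_{e ∉ T} α_e`, summing over spanning trees `T`
-- of `G`, a polynomial in variables indexed by the edges of `G`.
open Classical in
noncomputable def kirchhoff {V : Type} [Fintype V] [DecidableEq V]
    (G : SimpleGraph V) [DecidableRel G.Adj] : MvPolynomial ↥G.edgeFinset ℤ :=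
  ∑ T ∈ G.edgeFinset.powerset.filter
      (fun T => (SimpleGraph.fromEdgeSet (T : Set (Sym2 V))).IsTree),
    ∏ e ∈ Finset.univ.filter (fun e : ↥G.edgeFinset => (e : Sym2 V) ∉ T), X e

instance instDecidableRelInduce {V : Type} (G : SimpleGraph V) [DecidableRel G.Adj]
    (s : Set V) : DecidableRel (G.induce s).Adj :=
  fun a b => ‹DecidableRel G.Adj› ↑a ↑b

instance instDecidableMemNe {V : Type} [DecidableEq V] (v : V) :
    DecidablePred (· ∈ {w : V | w ≠ v}) := fun w => by
  simp only [Set.mem_setOf_eq]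
  infer_instance

-- The spanning forest polynomial `Φ^{b,ac}_H = ∑_F ∏_{e ∉ F} α_e`, summing over
-- spanning forests `F` of `H` consisting of exactly two trees, one containing `b` and
-- the other containing both `a` and `c`.
open Classical in
noncomputable def forestPoly {W : Type} [Fintype W] [DecidableEq W]
    (H : SimpleGraph W) [DecidableRel H.Adj] (b a c : W) :
    MvPolynomial ↥H.edgeFinset ℤ :=
  ∑ F ∈ H.edgeFinset.powerset.filter (fun F =>
      (SimpleGraph.fromEdgeSet (F : Set (Sym2 W))).IsAcyclic ∧
      (SimpleGraph.fromEdgeSet (F : Set (Sym2 W))).Reachable a c ∧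
      ¬ (SimpleGraph.fromEdgeSet (F : Set (Sym2 W))).Reachable a b ∧
      ∀ w, (SimpleGraph.fromEdgeSet (F : Set (Sym2 W))).Reachable w a ∨
           (SimpleGraph.fromEdgeSet (F : Set (Sym2 W))).Reachable w b),
    ∏ e ∈ Finset.univ.filter (fun e : ↥H.edgeFinset => (e : Sym2 W) ∉ F), X e

/-- A graph is internally 6-edge-connected if removing any set of at most 5 edges
results in at most one connected component containing an edge. -/
def InternallySixEdgeConnected {W : Type} (K : SimpleGraph W) : Prop :=
  ∀ S : Finset (Sym2 W), (S : Set (Sym2 W)) ⊆ K.edgeSet → S.card ≤ 5 →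
    ∀ a b c d : W, (K.deleteEdges (S : Set (Sym2 W))).Adj a b →
      (K.deleteEdges (S : Set (Sym2 W))).Adj c d →
      (K.deleteEdges (S : Set (Sym2 W))).Reachable a c

/-- `G` is primitive divergent: `G` is connected and is the decompletion `K - v` of a
connected, 4-regular, internally 6-edge-connected simple graph `K` (here realized on
vertex set `Option V` with deleted vertex `none`). -/
def IsPrimitiveDivergent {V : Type} [Fintype V] (G : SimpleGraph V) : Prop :=
  G.Connected ∧
  ∃ K : SimpleGraph (Option V),
    K.Connected ∧ (∀ w, (K.neighborSet w).ncard = 4) ∧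
    InternallySixEdgeConnected K ∧
    ∀ a b : V, K.Adj (some a) (some b) ↔ G.Adj a b

set_option linter.unusedSectionVars false
set_option linter.unusedSimpArgs false

section PartA
variable {V : Type} [Fintype V] [DecidableEq V] {K : Type} [CommRing K]

/-- rows in `R` replaced by unit rows -/
def Rw (A : Matrix V V K) (R : Finset V) : Matrix V V K :=
  Matrix.of fun i j => if i ∈ R then (if i = j then 1 else 0) else A i j

def Dm (A : Matrix V V K) (R : Finset V) : K := (Rw A R).det

def lap (y : Sym2 V → K) : Matrix V V K :=
  Matrix.of fun i j => (if i = j then ∑ x, y s(i, x) else 0) - y s(i, j)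

def Good (R : Finset V) (φ : V → V) : Prop :=
  (∀ r ∈ R, φ r = r) ∧ ∃ rk : V → ℕ, ∀ i ∉ R, rk (φ i) < rk i

def phiMat (K : Type) [CommRing K] (R : Finset V) (φ : V → V) : Matrix V V K :=
  Matrix.of fun i => if i ∈ R then Pi.single i 1 else Pi.single i 1 - Pi.single (φ i) 1

theorem det_phiMat_good (R : Finset V) (φ : V → V) (h : Good R φ) :
    (phiMat K R φ).det = 1 := by
  obtain ⟨h1, rk, hrk⟩ := h
  have hB : (phiMat K R φ).BlockTriangular (fun i => OrderDual.toDual (rk i)) := by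
    intro i j hij
    simp only [OrderDual.toDual_lt_toDual] at hij
    have hne : j ≠ i := by rintro rfl; exact lt_irrefl _ hij
    by_cases hi : i ∈ R
    · simp [phiMat, hi, Pi.single_apply, hne]
    · have : j ≠ φ i := by
        rintro rfl
        exact absurd (hrk i hi) (by omega)
      simp [phiMat, hi, Pi.single_apply, hne, this]
  rw [hB.det]
  apply Finset.prod_eq_one
  intro a _
  have : (phiMat K R φ).toSquareBlock (fun i => OrderDual.toDual (rk i)) a = 1 := by
    ext ⟨i, hi⟩ ⟨j, hj⟩
    have hij : rk i = rk j := by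
      have := hi.trans hj.symm
      simpa using this
    simp only [Matrix.toSquareBlock_def, Matrix.of_apply, Matrix.one_apply, phiMat]
    by_cases hR : i ∈ R
    · simp [hR, Pi.single_apply, eq_comm]
    · have : j ≠ φ i := by
        rintro rfl
        exact absurd (hrk i hR) (by omega)
      simp [hR, Pi.single_apply, this, eq_comm]
  rw [this, Matrix.det_one]

theorem det_phiMat_bad (R : Finset V) (φ : V → V) (h1 : ∀ r ∈ R, φ r = r) (h : ¬ Good R φ) :
    (phiMat K R φ).det = 0 := by
  have hZ : (phiMat ℤ R φ).det = 0 := by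
    classical
    rw [← Matrix.exists_mulVec_eq_zero_iff]
    refine ⟨fun w => if ∀ k, φ^[k] w ∉ R then 1 else 0, ?_, ?_⟩
    · intro h0
      apply h
      refine ⟨h1, ?_⟩
      have hex : ∀ w, ∃ k, φ^[k] w ∈ R := by
        intro w
        have := congrFun h0 w
        by_contra hc
        push Not at hc
        simp [hc] at this
      refine ⟨fun w => Nat.find (hex w), ?_⟩
      intro i hi
      have hs := Nat.find_spec (hex i)
      have hpos : Nat.find (hex i) ≠ 0 := by
        intro h0
        rw [h0] at hs
        exact hi hs
      obtain ⟨k, hk⟩ := Nat.exists_eq_succ_of_ne_zero hpos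
      rw [hk, Function.iterate_succ_apply] at hs
      have := Nat.find_min' (hex (φ i)) hs
      simp only
      omega
    · ext i
      by_cases hi : i ∈ R
      · have : ¬ ∀ k, φ^[k] i ∉ R := fun hc => hc 0 hi
        have h2 : ¬ ∀ k, φ^[k] i ∉ R := this
        simp only [Matrix.mulVec, phiMat, hi, Matrix.of_apply, if_true, single_one_dotProduct, Pi.zero_apply]
        rw [if_neg h2]
      · have : (∀ k, φ^[k] i ∉ R) ↔ ∀ k, φ^[k] (φ i) ∉ R := by
          constructor
          · intro hh k
            have := hh (k+1)
            rwa [Function.iterate_succ_apply] at this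
          · intro hh k
            cases k with
            | zero => exact hi
            | succ k => rw [Function.iterate_succ_apply]; exact hh k
        simp only [Matrix.mulVec, phiMat, hi, Matrix.of_apply, if_false, sub_dotProduct, single_one_dotProduct, Pi.zero_apply, this, sub_self]
  have : phiMat K R φ = (phiMat ℤ R φ).map (Int.castRingHom K) := by
    ext i j
    by_cases hi : i ∈ R <;> simp [phiMat, hi, Pi.single_apply] <;> split_ifs <;> simp
  rw [this, ← RingHom.mapMatrix_apply, ← RingHom.map_det, hZ, map_zero]

open Classical in
theorem Dm_lap_eq (R : Finset V) (y : Sym2 V → K) :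
    Dm (lap y) R = ∑ φ ∈ Finset.univ.filter (fun φ : V → V => Good R φ),
      ∏ i ∈ Finset.univ.filter (fun i => i ∉ R), y s(i, φ i) := by
  have h1 : Rw (lap y) R = Matrix.of fun i => ∑ x : V,
      (if i ∈ R then (if x = i then (1:K) else 0) else y s(i, x)) •
      (if i ∈ R then (Pi.single i 1 : V → K) else Pi.single i 1 - Pi.single x 1) := by
    ext i j
    by_cases hi : i ∈ R
    · simp [Rw, hi, Pi.single_apply, eq_comm]
    · simp only [Rw, hi, lap, Matrix.of_apply, if_false, Finset.sum_apply, Pi.smul_apply, Pi.sub_apply,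
        Pi.single_apply, smul_eq_mul, mul_sub, Finset.sum_sub_distrib]
      congr 1
      · by_cases hij : i = j
        · simp [hij]
        · simp [hij, Ne.symm hij]
      · simp
  have h2 := (Matrix.detRowAlternating (n := V) (R := K)).toMultilinearMap.map_sum
    (fun i (x : V) => (if i ∈ R then (if x = i then (1:K) else 0) else y s(i, x)) •
      (if i ∈ R then (Pi.single i 1 : V → K) else Pi.single i 1 - Pi.single x 1))
  have h3 : Dm (lap y) R = ∑ φ : V → V, (∏ i, (if i ∈ R then (if φ i = i then (1:K) else 0) else y s(i, φ i))) * (phiMat K R φ).det := by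
    rw [Dm, h1]
    refine Eq.trans h2 ?_
    apply Finset.sum_congr rfl
    intro φ _
    rw [MultilinearMap.map_smul_univ]
    rfl
  rw [h3, Finset.sum_filter]
  apply Finset.sum_congr rfl
  intro φ _
  by_cases hf : ∀ r ∈ R, φ r = r
  · split_ifs with hg
    · rw [det_phiMat_good R φ hg, mul_one, Finset.prod_filter]
      apply Finset.prod_congr rfl
      intro i _
      by_cases hi : i ∈ R
      · simp [hi, hf i hi]
      · simp [hi]
    · rw [det_phiMat_bad R φ hf hg, mul_zero]
  · rw [if_neg (fun hg => hf hg.1)]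
    push Not at hf
    obtain ⟨r, hr, hne⟩ := hf
    rw [Finset.prod_eq_zero (Finset.mem_univ r), zero_mul]
    simp [hr, hne]

end PartA

section PartA2
variable {V : Type} [Fintype V] [DecidableEq V]

theorem reach_closed {G : SimpleGraph V} (S : V → Prop) (h : ∀ x y, G.Adj x y → S x → S y)
    {x y : V} (hr : G.Reachable x y) (hx : S x) : S y := by
  obtain ⟨p⟩ := hr
  induction p with
  | nil => exact hx
  | cons hadj _ ih => exact ih (h _ _ hadj hx)

def Rooted (R : Finset V) (F : Finset (Sym2 V)) : Prop :=
  (SimpleGraph.fromEdgeSet (F : Set (Sym2 V))).IsAcyclic ∧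
  (∀ w, ∃ r ∈ R, (SimpleGraph.fromEdgeSet (F : Set (Sym2 V))).Reachable w r) ∧
  ∀ r ∈ R, ∀ r' ∈ R, (SimpleGraph.fromEdgeSet (F : Set (Sym2 V))).Reachable r r' → r = r'

def edgesOf (R : Finset V) (φ : V → V) : Finset (Sym2 V) :=
  (Finset.univ.filter (fun i => i ∉ R)).image (fun i => s(i, φ i))

theorem Good.ne {R : Finset V} {φ : V → V} (h : Good R φ) {i : V} (hi : i ∉ R) : φ i ≠ i := by
  obtain ⟨_, rk, hrk⟩ := h
  intro he
  have := hrk i hi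
  rw [he] at this
  exact lt_irrefl _ this

theorem Good.inj {R : Finset V} {φ : V → V} (h : Good R φ) {i j : V} (hi : i ∉ R) (hj : j ∉ R)
    (he : s(i, φ i) = s(j, φ j)) : i = j := by
  obtain ⟨_, rk, hrk⟩ := h
  rw [Sym2.eq_iff] at he
  rcases he with ⟨h1, _⟩ | ⟨h1, h2⟩
  · exact h1
  · have a := hrk i hi
    have b := hrk j hj
    rw [h2] at a
    rw [← h1] at b
    omega

theorem Good.adj_iff {R : Finset V} {φ : V → V} (h : Good R φ) (x y : V) :
    (SimpleGraph.fromEdgeSet (edgesOf R φ : Set (Sym2 V))).Adj x y ↔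
      (x ∉ R ∧ φ x = y) ∨ (y ∉ R ∧ φ y = x) := by
  rw [SimpleGraph.fromEdgeSet_adj]
  simp only [edgesOf, Finset.coe_image, Set.mem_image, Finset.mem_coe, Finset.mem_filter,
    Finset.mem_univ, true_and]
  constructor
  · rintro ⟨⟨i, hi, he⟩, hne⟩
    rw [Sym2.eq_iff] at he
    rcases he with ⟨h1, h2⟩ | ⟨h1, h2⟩
    · subst h1; exact Or.inl ⟨hi, h2⟩
    · subst h1; exact Or.inr ⟨hi, h2⟩
  · rintro (⟨hx, rfl⟩ | ⟨hy, rfl⟩)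
    · exact ⟨⟨x, hx, rfl⟩, (h.ne hx).symm⟩
    · exact ⟨⟨y, hy, Sym2.eq_swap⟩, h.ne hy⟩

theorem Good.reach {R : Finset V} {φ : V → V} (h : Good R φ) (w : V) :
    ∃ r ∈ R, (SimpleGraph.fromEdgeSet (edgesOf R φ : Set (Sym2 V))).Reachable w r := by
  obtain ⟨_, rk, hrk⟩ := id h
  induction hn : rk w using Nat.strong_induction_on generalizing w with
  | _ n ih =>
    by_cases hw : w ∈ R
    · exact ⟨w, hw, SimpleGraph.Reachable.refl _⟩
    · obtain ⟨r, hr, hre⟩ := ih _ (hn ▸ hrk w hw) (φ w) rfl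
      refine ⟨r, hr, SimpleGraph.Reachable.trans (SimpleGraph.Adj.reachable ?_) hre⟩
      rw [h.adj_iff]
      exact Or.inl ⟨hw, rfl⟩

theorem Good.iter_rk {R : Finset V} {φ : V → V} (h1 : ∀ r ∈ R, φ r = r) {rk : V → ℕ}
    (hrk : ∀ i ∉ R, rk (φ i) < rk i) (k : ℕ) (x : V) : rk (φ^[k] x) ≤ rk x := by
  induction k generalizing x with
  | zero => exact le_rfl
  | succ k ih =>
    rw [Function.iterate_succ_apply]
    refine (ih _).trans ?_
    by_cases hx : x ∈ R
    · rw [h1 x hx]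
    · exact (hrk x hx).le

theorem Good.rooted {R : Finset V} {φ : V → V} (h : Good R φ) : Rooted R (edgesOf R φ) := by
  refine ⟨?_, h.reach, ?_⟩
  · -- acyclic
    obtain ⟨h1, rk, hrk⟩ := id h
    rw [SimpleGraph.isAcyclic_iff_forall_adj_isBridge]
    have key : ∀ u, u ∉ R → ¬ ((SimpleGraph.fromEdgeSet (edgesOf R φ : Set (Sym2 V))).deleteEdges {s(u, φ u)}).Reachable u (φ u) := by
      intro u hu hr
      have := reach_closed (fun x => ∃ k, φ^[k] x = u) ?_ hr ⟨0, rfl⟩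
      · obtain ⟨k, hk⟩ := this
        have h2 := Good.iter_rk h1 hrk k (φ u)
        rw [hk] at h2
        have := hrk u hu
        omega
      · rintro x y hadj ⟨k, hk⟩
        rw [SimpleGraph.deleteEdges_adj, h.adj_iff] at hadj
        obtain ⟨hxy | hxy, hne⟩ := hadj
        · obtain ⟨hx, rfl⟩ := hxy
          cases k with
          | zero =>
            simp only [Function.iterate_zero, id_eq] at hk
            subst hk
            exact absurd rfl hne
          | succ k => exact ⟨k, by rwa [Function.iterate_succ_apply] at hk⟩
        · obtain ⟨hy, rfl⟩ := hxy
          exact ⟨k+1, by rwa [Function.iterate_succ_apply]⟩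
    intro x y hxy
    rw [SimpleGraph.isBridge_iff]
    rw [h.adj_iff] at hxy
    rcases hxy with ⟨hx, rfl⟩ | ⟨hy, rfl⟩
    · exact key x hx
    · intro hr
      apply key y hy
      rw [Sym2.eq_swap] at hr
      exact hr.symm
  · intro r hr r' hr' hre
    obtain ⟨h1, rk, hrk⟩ := id h
    have := reach_closed (fun x => ∃ k, φ^[k] x = r) ?_ hre ⟨0, rfl⟩
    · obtain ⟨k, hk⟩ := this
      rw [← hk, Function.iterate_fixed (h1 r' hr')]
    · rintro x y hadj ⟨k, hk⟩
      rw [h.adj_iff] at hadj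
      rcases hadj with ⟨hx, rfl⟩ | ⟨hy, rfl⟩
      · cases k with
        | zero =>
          simp only [Function.iterate_zero, id_eq] at hk
          rw [hk] at hx
          exact absurd hr hx
        | succ k => exact ⟨k, by rwa [Function.iterate_succ_apply] at hk⟩
      · exact ⟨k+1, by rwa [Function.iterate_succ_apply]⟩

theorem Good.card {R : Finset V} {φ : V → V} (h : Good R φ) :
    (edgesOf R φ).card = Fintype.card V - R.card := by
  rw [edgesOf, Finset.card_image_of_injOn]
  · rw [show Finset.univ.filter (fun i => i ∉ R) = Rᶜ by ext; simp, Finset.card_compl]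
  · intro i hi j hj he
    simp only [Finset.coe_filter, Finset.mem_univ, true_and, Set.mem_ofPred_eq] at hi hj
    exact h.inj hi hj he

theorem Good.uniq {R : Finset V} {φ ψ : V → V} (h : Good R φ) (h' : Good R ψ)
    (he : edgesOf R φ = edgesOf R ψ) : φ = ψ := by
  obtain ⟨h1, rk, hrk⟩ := id h'
  have key : ∀ n u, rk u = n → u ∉ R → φ u = ψ u := by
    intro n
    induction n using Nat.strong_induction_on with
    | _ n ih =>
      intro u hn hu
      by_contra hne
      have hadj : (SimpleGraph.fromEdgeSet (edgesOf R ψ : Set (Sym2 V))).Adj u (ψ u) := by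
        rw [h'.adj_iff]; exact Or.inl ⟨hu, rfl⟩
      rw [← he, h.adj_iff] at hadj
      rcases hadj with ⟨_, h2⟩ | ⟨h2, h3⟩
      · exact hne h2
      · have hlt := hrk u hu
        have h4 := ih _ (hn ▸ hlt) (ψ u) rfl h2
        rw [h3] at h4
        have h5 := hrk (ψ u) h2
        rw [← h4] at h5
        omega
  funext u
  by_cases hu : u ∈ R
  · rw [h.1 u hu, h1 u hu]
  · exact key _ u rfl hu

theorem Rooted.exists_good {R : Finset V} {F : Finset (Sym2 V)} (h : Rooted R F)
    (hd : ∀ e ∈ F, ¬ e.IsDiag) : ∃ φ, Good R φ ∧ edgesOf R φ = F := by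
  obtain ⟨hac, hre, hun⟩ := h
  set G := SimpleGraph.fromEdgeSet (F : Set (Sym2 V)) with hG
  choose root hroot hreach using hre
  have hrr : ∀ r ∈ R, root r = r := fun r hr => (hun r hr _ (hroot r) (hreach r)).symm
  have hrad : ∀ x y, G.Adj x y → root x = root y := fun x y hxy =>
    hun _ (hroot x) _ (hroot y) (((hreach x).symm.trans hxy.reachable).trans (hreach y))
  have hstep : ∀ u, ∃ x, (u ∈ R → x = u) ∧ (u ∉ R → G.Adj u x ∧ G.dist x (root x) < G.dist u (root u)) := by
    intro u
    by_cases hu : u ∈ R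
    · exact ⟨u, fun _ => rfl, fun h => absurd hu h⟩
    · obtain ⟨p, hp⟩ := (hreach u).exists_walk_length_eq_dist
      have hur : u ≠ root u := fun h => hu (h ▸ hroot u)
      obtain ⟨x, hx, q, hq⟩ := SimpleGraph.Walk.exists_eq_cons_of_ne hur p
      refine ⟨x, fun h => absurd h hu, fun _ => ⟨hx, ?_⟩⟩
      rw [← hp, hq, SimpleGraph.Walk.length_cons, ← hrad u x hx]
      exact Nat.lt_succ_of_le (SimpleGraph.dist_le q)
  choose φ hφ1 hφ2 using hstep
  have hgood : Good R φ := ⟨hφ1, fun u => G.dist u (root u), fun i hi => (hφ2 i hi).2⟩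
  refine ⟨φ, hgood, ?_⟩
  have hle : edgesOf R φ ⊆ F := by
    intro e he
    simp only [edgesOf, Finset.mem_image, Finset.mem_filter, Finset.mem_univ, true_and] at he
    obtain ⟨i, hi, rfl⟩ := he
    have := (hφ2 i hi).1
    rw [hG, SimpleGraph.fromEdgeSet_adj] at this
    exact this.1
  apply Finset.Subset.antisymm hle
  intro e he
  induction e with
  | _ x y =>
  by_contra hne
  have hxy : x ≠ y := by simpa using hd _ he
  have hadj : G.Adj x y := by
    rw [hG, SimpleGraph.fromEdgeSet_adj]; exact ⟨he, hxy⟩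
  rw [SimpleGraph.isAcyclic_iff_forall_adj_isBridge] at hac
  have hb := hac hadj
  rw [SimpleGraph.isBridge_iff] at hb
  apply hb
  have hsub : SimpleGraph.fromEdgeSet (edgesOf R φ : Set (Sym2 V)) ≤ G.deleteEdges {s(x, y)} := by
    intro u w huw
    rw [SimpleGraph.fromEdgeSet_adj] at huw
    rw [SimpleGraph.deleteEdges_adj, hG, SimpleGraph.fromEdgeSet_adj]
    refine ⟨⟨hle huw.1, huw.2⟩, ?_⟩
    intro h3
    rw [Set.mem_singleton_iff] at h3
    rw [h3] at huw
    exact hne huw.1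
  obtain ⟨r, hr, h1⟩ := hgood.reach x
  obtain ⟨r', hr', h2⟩ := hgood.reach y
  have h1' := h1.mono hsub
  have h2' := h2.mono hsub
  have hdl : G.deleteEdges {s(x, y)} ≤ G := SimpleGraph.deleteEdges_le _
  have : r = r' := hun r hr r' hr' (((h1'.mono hdl).symm.trans hadj.reachable).trans (h2'.mono hdl))
  subst this
  exact h1'.trans h2'.symm

open Classical in
theorem forest_thm {K : Type} [CommRing K] (R : Finset V) (E : Finset (Sym2 V))
    (hE : ∀ e ∈ E, ¬ e.IsDiag) (y : Sym2 V → K) (hy : ∀ e ∉ E, y e = 0) :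
    Dm (lap y) R = ∑ F ∈ E.powerset.filter (fun F => Rooted R F), ∏ e ∈ F, y e := by
  rw [Dm_lap_eq]
  have h1 : ∑ φ ∈ Finset.univ.filter (fun φ : V → V => Good R φ),
      ∏ i ∈ Finset.univ.filter (fun i => i ∉ R), y s(i, φ i) =
      ∑ φ ∈ Finset.univ.filter (fun φ : V → V => Good R φ ∧ edgesOf R φ ⊆ E),
      ∏ i ∈ Finset.univ.filter (fun i => i ∉ R), y s(i, φ i) := by
    symm
    apply Finset.sum_subset
    · intro φ; simp +contextual
    · intro φ hφ hφ'
      simp only [Finset.mem_filter, Finset.mem_univ, true_and, not_and] at hφ hφ'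
      have := hφ' hφ
      rw [Finset.not_subset] at this
      obtain ⟨e, he, heE⟩ := this
      simp only [edgesOf, Finset.mem_image] at he
      obtain ⟨i, hi, rfl⟩ := he
      exact Finset.prod_eq_zero hi (hy _ heE)
  rw [h1]
  refine Finset.sum_bij (fun φ _ => edgesOf R φ) ?_ ?_ ?_ ?_
  · intro φ hφ
    simp only [Finset.mem_filter, Finset.mem_univ, true_and, Finset.mem_powerset] at hφ ⊢
    exact ⟨hφ.2, hφ.1.rooted⟩
  · intro φ hφ ψ hψ he
    simp only [Finset.mem_filter, Finset.mem_univ, true_and] at hφ hψ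
    exact hφ.1.uniq hψ.1 he
  · intro F hF
    simp only [Finset.mem_filter, Finset.mem_powerset] at hF
    obtain ⟨φ, h1, h2⟩ := hF.2.exists_good (fun e he => hE e (hF.1 he))
    exact ⟨φ, by simp [h1, h2, hF.1], h2⟩
  · intro φ hφ
    simp only [Finset.mem_filter, Finset.mem_univ, true_and] at hφ
    rw [edgesOf, Finset.prod_image]
    intro i hi j hj he
    simp only [Finset.coe_filter, Finset.mem_univ, true_and, Set.mem_ofPred_eq] at hi hj
    exact hφ.1.inj hi hj he

theorem Rooted.card {R : Finset V} {F : Finset (Sym2 V)} (h : Rooted R F)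
    (hd : ∀ e ∈ F, ¬ e.IsDiag) : F.card = Fintype.card V - R.card := by
  obtain ⟨φ, h1, rfl⟩ := h.exists_good hd
  exact h1.card

end PartA2

section PartB
variable {V : Type} [Fintype V] [DecidableEq V] {K : Type} [CommRing K]

theorem Dm_congr (A B : Matrix V V K) (R : Finset V)
    (h : ∀ i ∉ R, ∀ j ∉ R, A i j = B i j) : Dm A R = Dm B R := by
  have key : ∀ A : Matrix V V K, Dm A R = ((Rw A R).toSquareBlockProp (fun i => i ∉ R)).det *
      ((Rw A R).toSquareBlockProp (fun i => ¬ i ∉ R)).det := by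
    intro A
    apply Matrix.twoBlockTriangular_det
    intro i hi j hj
    have hi' : i ∈ R := by simpa using hi
    have : i ≠ j := by rintro rfl; exact hj hi'
    simp [Rw, hi', this]
  rw [key A, key B]
  congr 1
  · congr 1
    ext ⟨i, hi⟩ ⟨j, hj⟩
    simp [Matrix.toSquareBlockProp, Rw, hi, h i hi j hj]
  · congr 1
    ext ⟨i, hi⟩ ⟨j, hj⟩
    have hi' : i ∈ R := by simpa using hi
    simp [Matrix.toSquareBlockProp, Rw, hi']

theorem Dm_add_diag (A : Matrix V V K) (R : Finset V) (a : V) (ha : a ∉ R) (t : K) :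
    Dm (A + Matrix.single a a t) R = Dm A R + t * Dm A (insert a R) := by
  have h1 : Rw (A + Matrix.single a a t) R =
      (Rw A R).updateRow a ((Rw A R) a + t • (Pi.single a 1 : V → K)) := by
    ext i j
    by_cases hia : i = a
    · subst hia
      simp [Rw, ha, Matrix.single_apply, Pi.single_apply, eq_comm]
    · rw [Matrix.updateRow_ne hia]
      simp [Rw, Matrix.single_apply, Ne.symm hia]
  have h2 : (Rw A R).updateRow a (Pi.single a 1 : V → K) = Rw A (insert a R) := by
    ext i j
    by_cases hia : i = a
    · subst hia
      simp [Rw, Pi.single_apply, eq_comm]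
    · rw [Matrix.updateRow_ne hia]
      simp [Rw, hia]
  rw [Dm, h1, Matrix.det_updateRow_add, Matrix.updateRow_eq_self, Matrix.det_updateRow_smul, h2]
  rfl

theorem Dm_empty (A : Matrix V V K) : Dm A ∅ = A.det := by
  rw [Dm]; congr 1

theorem Rw_insert (A : Matrix V V K) (R : Finset V) (a : V) :
    (Rw A R).updateRow a (Pi.single a 1 : V → K) = Rw A (insert a R) := by
  ext i j
  by_cases hia : i = a
  · subst hia
    simp [Rw, Pi.single_apply, eq_comm]
  · rw [Matrix.updateRow_ne hia]
    simp [Rw, hia]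

/-- symmetric version -/
def Sy (A : Matrix V V K) (R : Finset V) : Matrix V V K :=
  Matrix.of fun i j => if i ∈ R ∨ j ∈ R then (if i = j then 1 else 0) else A i j

theorem Dm_Sy (A : Matrix V V K) (R S : Finset V) : Dm (Sy A R) S = Dm A (R ∪ S) := by
  have h1 : Dm A (R ∪ S) = Dm (Sy A R) (R ∪ S) := by
    apply Dm_congr
    intro i hi j hj
    simp only [Finset.mem_union, not_or] at hi hj
    simp [Sy, hi.1, hj.1]
  rw [h1, Dm, Dm]
  congr 1
  ext i j
  by_cases hS : i ∈ S
  · simp [Rw, hS]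
  · by_cases hR : i ∈ R
    · simp [Rw, Sy, hS, hR]
    · simp [Rw, hS, hR]

theorem det_two_rows (b c : V) (hbc : b ≠ c) (r s : V → K) :
    (((1 : Matrix V V K).updateRow b r).updateRow c s).det = r b * s c - r c * s b := by
  let U : Matrix V (Fin 2) K := Matrix.of fun i k => if i = ![b, c] k then 1 else 0
  let W : Matrix (Fin 2) V K := Matrix.of ![r - Pi.single b 1, s - Pi.single c 1]
  have h : ((1 : Matrix V V K).updateRow b r).updateRow c s = 1 + U * W := by
    ext i j
    by_cases hc : i = c
    · subst hc
      simp [U, W, Matrix.mul_apply, Fin.sum_univ_two, hbc.symm, Matrix.one_apply, Pi.single_apply,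
        eq_comm]
    · rw [Matrix.updateRow_ne hc]
      by_cases hb : i = b
      · subst hb
        simp [U, W, Matrix.mul_apply, Fin.sum_univ_two, hbc, Matrix.one_apply, Pi.single_apply,
          eq_comm]
      · rw [Matrix.updateRow_ne hb]
        simp [U, W, Matrix.mul_apply, Fin.sum_univ_two, hb, hc]
  rw [h, Matrix.det_one_add_mul_comm, Matrix.det_fin_two]
  have e : ∀ k l, (W * U) k l = W k (![b, c] l) := by
    intro k l
    simp [Matrix.mul_apply, U]
  simp only [Matrix.add_apply, e]
  simp [W, hbc, hbc.symm, Pi.single_apply, Matrix.one_apply]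

theorem jacobi_aux (M : Matrix V V K) (b c : V) (hbc : b ≠ c) :
    M.det * (M.det * ((M.updateRow b (Pi.single b 1)).updateRow c (Pi.single c 1)).det) =
    M.det * (M.adjugate b b * M.adjugate c c - M.adjugate b c * M.adjugate c b) := by
  have h1 := det_two_rows b c hbc (M.adjugate b) (M.adjugate c)
  have h2 : (((1 : Matrix V V K).updateRow b (M.adjugate b)).updateRow c (M.adjugate c)) * M =
      (M.updateRow b (M.det • Pi.single b 1)).updateRow c (M.det • Pi.single c 1) := by
    have h3 := Matrix.adjugate_mul M
    ext i j
    by_cases hc : i = c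
    · subst hc
      have := congrFun (congrFun h3 i) j
      rw [Matrix.mul_apply] at this ⊢
      simp only [Matrix.updateRow_self]
      rw [this]
      simp [Matrix.one_apply, Pi.single_apply, eq_comm]
    · rw [Matrix.updateRow_ne hc]
      by_cases hb : i = b
      · subst hb
        have := congrFun (congrFun h3 i) j
        rw [Matrix.mul_apply] at this ⊢
        simp only [Matrix.updateRow_ne hc, Matrix.updateRow_self]
        rw [this]
        simp [Matrix.one_apply, Pi.single_apply, eq_comm]
      · rw [Matrix.updateRow_ne hb, Matrix.mul_apply]
        simp [Matrix.updateRow_ne hc, Matrix.updateRow_ne hb, Matrix.one_apply]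
  have h4 := congrArg Matrix.det h2
  rw [Matrix.det_mul, h1, Matrix.det_updateRow_smul, Matrix.updateRow_comm _ hbc, Matrix.det_updateRow_smul,
    Matrix.updateRow_comm _ hbc.symm] at h4
  linear_combination -h4

theorem jacobi (M : Matrix V V K) (b c : V) (hbc : b ≠ c) :
    M.det * ((M.updateRow b (Pi.single b 1)).updateRow c (Pi.single c 1)).det =
    M.adjugate b b * M.adjugate c c - M.adjugate b c * M.adjugate c b := by
  have h0 := mul_left_cancel₀ (Matrix.det_mvPolynomialX_ne_zero V ℤ)
    (jacobi_aux (Matrix.mvPolynomialX V V ℤ) b c hbc)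
  let f : MvPolynomial (V × V) ℤ →+* K := (MvPolynomial.aeval (fun ij : V × V => M ij.1 ij.2)).toRingHom
  have hf : f.mapMatrix (Matrix.mvPolynomialX V V ℤ) = M := by
    ext i j; simp [f]
  have h1 := congrArg f h0
  have hu : ∀ (N : Matrix V V (MvPolynomial (V × V) ℤ)) (i : V),
      f.mapMatrix (N.updateRow i (Pi.single i 1)) = (f.mapMatrix N).updateRow i (Pi.single i 1) := by
    intro N i
    ext k l
    by_cases hk : k = i
    · subst hk; simp [Pi.single_apply]
    · simp [Matrix.updateRow_ne hk]
  have ha : ∀ i j, f ((Matrix.mvPolynomialX V V ℤ).adjugate i j) = M.adjugate i j := by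
    intro i j
    have := congrFun (congrFun (RingHom.map_adjugate f (Matrix.mvPolynomialX V V ℤ)) i) j
    rw [hf] at this
    simpa using this
  rw [map_mul, RingHom.map_det, RingHom.map_det, hu, hu, hf, map_sub, map_mul, map_mul, ha, ha, ha, ha] at h1
  exact h1

theorem lap_symm (y : Sym2 V → K) (i j : V) : lap y i j = lap y j i := by
  simp only [lap, Matrix.of_apply]
  rw [Sym2.eq_swap]
  by_cases h : i = j
  · subst h; rfl
  · simp [h, Ne.symm h]

theorem lap_edge (y : Sym2 V → K) (t : K) (a b : V) (R : Finset V) (ha : a ∈ R) (hb : b ∉ R) :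
    Dm (lap (fun e => y e + if e = s(a, b) then t else 0)) R =
      Dm (lap y) R + t * Dm (lap y) (insert b R) := by
  rw [← Dm_add_diag _ _ _ hb]
  apply Dm_congr
  intro i hi j hj
  have hia : i ≠ a := by rintro rfl; exact hi ha
  have hja : j ≠ a := by rintro rfl; exact hj ha
  have hab : a ≠ b := by rintro rfl; exact hb ha
  have h1 : s(i, j) ≠ s(a, b) := by
    intro h; rw [Sym2.eq_iff] at h; rcases h with ⟨h, _⟩ | ⟨_, h⟩
    · exact hia h
    · exact hja h
  have h2 : ∑ x, (if s(i, x) = s(a, b) then t else 0) = if i = b then t else 0 := by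
    by_cases hib : i = b
    · subst hib
      rw [Finset.sum_eq_single a]
      · simp [Sym2.eq_swap]
      · intro x _ hx
        rw [if_neg]
        intro h; rw [Sym2.eq_iff] at h; rcases h with ⟨h, _⟩ | ⟨_, h⟩
        · exact hia h
        · exact hx h
      · simp
    · rw [if_neg hib]
      apply Finset.sum_eq_zero
      intro x _
      rw [if_neg]
      intro h; rw [Sym2.eq_iff] at h; rcases h with ⟨h, _⟩ | ⟨h, _⟩
      · exact hia h
      · exact hib h
  simp only [lap, Matrix.of_apply, Matrix.add_apply, h1, if_false, add_zero, Finset.sum_add_distrib, h2,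
    Matrix.single_apply]
  by_cases hij : i = j
  · subst hij
    by_cases hib : i = b
    · subst hib; simp; ring
    · simp [hib, Ne.symm hib]
  · have : ¬ (b = i ∧ b = j) := by rintro ⟨rfl, rfl⟩; exact hij rfl
    simp [hij, this]

theorem lap_edge' (y : Sym2 V → K) (t : K) (a b : V) (R : Finset V) (ha : a ∈ R) (hb : b ∈ R) :
    Dm (lap (fun e => y e + if e = s(a, b) then t else 0)) R = Dm (lap y) R := by
  apply Dm_congr
  intro i hi j hj
  have hx : ∀ x, s(i, x) ≠ s(a, b) := by
    intro x h; rw [Sym2.eq_iff] at h; rcases h with ⟨h, _⟩ | ⟨h, _⟩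
    · subst h; exact hi ha
    · subst h; exact hi hb
  simp only [lap, Matrix.of_apply, hx, if_false, add_zero]

theorem quad_identity (y : Sym2 V → K) (R : Finset V) (a b c : V) (ha : a ∉ R) (hb : b ∉ R)
    (hc : c ∉ R) (hab : a ≠ b) (hac : a ≠ c) (hbc : b ≠ c)
    (hy : ∀ r ∈ R, ∀ x, y s(x, r) = 0)
    (f0 : K) (h0 : Dm (lap y) R = 0) (hfa : Dm (lap y) (insert a R) = f0)
    (hfb : Dm (lap y) (insert b R) = f0) (hfc : Dm (lap y) (insert c R) = f0) :
    4 * f0 * Dm (lap y) (insert a (insert b (insert c R))) =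
      2 * (Dm (lap y) (insert a (insert b R)) * Dm (lap y) (insert a (insert c R)) +
        Dm (lap y) (insert a (insert b R)) * Dm (lap y) (insert b (insert c R)) +
        Dm (lap y) (insert a (insert c R)) * Dm (lap y) (insert b (insert c R))) -
      (Dm (lap y) (insert a (insert b R)) ^ 2 + Dm (lap y) (insert a (insert c R)) ^ 2 +
        Dm (lap y) (insert b (insert c R)) ^ 2) := by
  set A := lap y with hA
  set A1 := A + Matrix.single a a 1 + Matrix.single b b 1 + Matrix.single c c 1 with hA1
  set M := Sy A1 R with hM
  have hdet : M.det = Dm A1 R := by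
    rw [← Dm_empty, hM, Dm_Sy, Finset.union_empty]
  have hup : ∀ i, M.adjugate i i = Dm A1 (insert i R) := by
    intro i
    rw [Matrix.adjugate_apply]
    have : M = Rw M ∅ := by ext; simp [Rw]
    rw [this, Rw_insert]
    change Dm M _ = _
    rw [hM, Dm_Sy]
    congr 1
    ext; simp [or_comm]
  have hup2 : ((M.updateRow b (Pi.single b 1)).updateRow c (Pi.single c 1)).det =
      Dm A1 (insert b (insert c R)) := by
    have : M = Rw M ∅ := by ext; simp [Rw]
    rw [this, Rw_insert, Rw_insert]
    change Dm M _ = _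
    rw [hM, Dm_Sy]
    congr 1
    ext; simp; tauto
  have hsymA1 : ∀ i j, A1 i j = A1 j i := by
    intro i j
    simp only [hA1, Matrix.add_apply, Matrix.single_apply, hA, lap_symm y i j, and_comm]
  have hsym : ∀ i j, M.adjugate i j = M.adjugate j i := by
    intro i j
    have hT : M.transpose = M := by
      ext i j
      simp only [hM, Sy, Matrix.transpose_apply, Matrix.of_apply, hsymA1 i j, or_comm, eq_comm]
    have := Matrix.adjugate_transpose M
    rw [hT] at this
    exact congrFun (congrFun this j) i
  have hrow : ∀ i, ∑ j, A i j = 0 := by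
    intro i
    simp [hA, lap]
  have hA0 : ∀ i, ∀ j ∈ R, i ∉ R → A i j = 0 := by
    intro i j hj hi
    have : i ≠ j := by rintro rfl; exact hi hj
    simp [hA, lap, this, hy j hj i]
  have hmul : M.mulVec (fun w => if w ∈ R then 0 else 1) =
      fun w => (if w = a then 1 else 0) + (if w = b then 1 else 0) + (if w = c then 1 else 0) := by
    ext i
    simp only [Matrix.mulVec, dotProduct]
    by_cases hi : i ∈ R
    · have h1 : i ≠ a := by rintro rfl; exact ha hi
      have h2 : i ≠ b := by rintro rfl; exact hb hi
      have h3 : i ≠ c := by rintro rfl; exact hc hi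
      simp only [h1, h2, h3, if_false, add_zero]
      apply Finset.sum_eq_zero
      intro j _
      by_cases hj : j ∈ R
      · simp [hj]
      · have : i ≠ j := by rintro rfl; exact hj hi
        simp [hM, Sy, hi, this]
    · have : ∀ j, M i j * (if j ∈ R then 0 else 1) = A i j + (if j = a then (if i = a then 1 else 0) else 0)
          + (if j = b then (if i = b then 1 else 0) else 0) + (if j = c then (if i = c then 1 else 0) else 0) := by
        intro j
        by_cases hj : j ∈ R
        · have h1 : j ≠ a := by rintro rfl; exact ha hj
          have h2 : j ≠ b := by rintro rfl; exact hb hj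
          have h3 : j ≠ c := by rintro rfl; exact hc hj
          simp [hj, h1, h2, h3, hA0 i j hj hi]
        · simp only [hM, Sy, hi, hj, Matrix.of_apply, or_self, if_false, mul_one, hA1, Matrix.add_apply,
            Matrix.single_apply]
          congr 1
          · congr 1
            · congr 1
              by_cases h1 : j = a <;> by_cases h2 : i = a <;> simp [h1, h2, eq_comm] <;> tauto
            · by_cases h1 : j = b <;> by_cases h2 : i = b <;> simp [h1, h2, eq_comm] <;> tauto
          · by_cases h1 : j = c <;> by_cases h2 : i = c <;> simp [h1, h2, eq_comm] <;> tauto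
      rw [Finset.sum_congr rfl (fun j _ => this j)]
      simp [Finset.sum_add_distrib, hrow]
  have hadj : ∀ i, i ∉ R → M.adjugate i a + M.adjugate i b + M.adjugate i c = M.det := by
    intro i hi
    have h1 := congrArg (fun v => M.adjugate.mulVec v i) hmul
    simp only [Matrix.mulVec_mulVec, Matrix.adjugate_mul] at h1
    simp only [Matrix.smul_mulVec, Matrix.one_mulVec, Pi.smul_apply, hi, if_false, smul_eq_mul, mul_one] at h1
    rw [h1]
    simp [Matrix.mulVec, dotProduct, mul_add, Finset.sum_add_distrib]
  have J := jacobi M b c hbc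
  -- expansions
  have xc : ∀ S : Finset V, ∀ i ∈ S, ∀ B C : Matrix V V K, Dm (B + Matrix.single i i 1 + C) S = Dm (B + C) S := by
    intro S i hi B C
    apply Dm_congr
    intro k hk l hl
    have : i ≠ k := by rintro rfl; exact hk hi
    simp [Matrix.single_apply, this]
  have xc0 : ∀ S : Finset V, ∀ i ∈ S, ∀ B : Matrix V V K, Dm (B + Matrix.single i i 1) S = Dm B S := by
    intro S i hi B
    apply Dm_congr
    intro k hk l hl
    have : i ≠ k := by rintro rfl; exact hk hi
    simp [Matrix.single_apply, this]
  have ex : ∀ S : Finset V, ∀ i, ∀ B : Matrix V V K, Dm (B + Matrix.single i i 1) S =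
      Dm B S + if i ∈ S then 0 else Dm B (insert i S) := by
    intro S i B
    split_ifs with h
    · rw [xc0 S i h, add_zero]
    · rw [Dm_add_diag _ _ _ h, one_mul]
  have i1 : insert b (insert a R) = insert a (insert b R) := Finset.insert_comm _ _ _
  have i2 : insert c (insert a R) = insert a (insert c R) := Finset.insert_comm _ _ _
  have i3 : insert c (insert b R) = insert b (insert c R) := Finset.insert_comm _ _ _
  have i4 : insert c (insert a (insert b R)) = insert a (insert b (insert c R)) := by
    ext; simp; tauto
  have i5 : insert b (insert a (insert c R)) = insert a (insert b (insert c R)) := by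
    ext; simp; tauto
  have eT : Dm A1 R = 3 * f0 + Dm A (insert a (insert b R)) + Dm A (insert a (insert c R)) +
      Dm A (insert b (insert c R)) + Dm A (insert a (insert b (insert c R))) := by
    simp only [hA1, ex, Finset.mem_insert, ha, hb, hc, hab, hac, hbc, hab.symm, hac.symm, hbc.symm, or_false,
      or_self, if_false, h0, hfa, hfb, hfc, i1, i2, i3, i4, i5]
    ring
  have ea : Dm A1 (insert a R) = f0 + Dm A (insert a (insert b R)) + Dm A (insert a (insert c R)) +
      Dm A (insert a (insert b (insert c R))) := by
    simp only [hA1, ex, Finset.mem_insert, ha, hb, hc, hab, hac, hbc, hab.symm, hac.symm, hbc.symm, or_false,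
      or_self, if_false, h0, hfa, hfb, hfc, i1, i2, i3, i4, i5, true_or, if_true, or_true]
    ring
  have eb : Dm A1 (insert b R) = f0 + Dm A (insert a (insert b R)) + Dm A (insert b (insert c R)) +
      Dm A (insert a (insert b (insert c R))) := by
    simp only [hA1, ex, Finset.mem_insert, ha, hb, hc, hab, hac, hbc, hab.symm, hac.symm, hbc.symm, or_false,
      or_self, if_false, h0, hfa, hfb, hfc, i1, i2, i3, i4, i5, true_or, if_true, or_true]
    ring
  have ec : Dm A1 (insert c R) = f0 + Dm A (insert a (insert c R)) + Dm A (insert b (insert c R)) +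
      Dm A (insert a (insert b (insert c R))) := by
    simp only [hA1, ex, Finset.mem_insert, ha, hb, hc, hab, hac, hbc, hab.symm, hac.symm, hbc.symm, or_false,
      or_self, if_false, h0, hfa, hfb, hfc, i1, i2, i3, i4, i5, true_or, if_true, or_true]
    ring
  have ebc : Dm A1 (insert b (insert c R)) = Dm A (insert b (insert c R)) +
      Dm A (insert a (insert b (insert c R))) := by
    simp only [hA1, ex, Finset.mem_insert, ha, hb, hc, hab, hac, hbc, hab.symm, hac.symm, hbc.symm, or_false,
      or_self, if_false, h0, hfa, hfb, hfc, i1, i2, i3, i4, i5, true_or, if_true, or_true]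
    ring
  have q1 := hadj a ha
  have q2 := hadj b hb
  have q3 := hadj c hc
  rw [hup2, hup, hup, hsym c b, hdet, eT, eb, ec, ebc] at J
  rw [hup, hdet, eT, ea] at q1
  rw [hup, hdet, eT, eb, hsym b a] at q2
  rw [hup, hdet, eT, ec, hsym c a, hsym c b] at q3
  generalize M.adjugate a b = x at *
  generalize M.adjugate a c = y at *
  generalize M.adjugate b c = z at *
  generalize Dm A (insert a (insert b R)) = d1 at *
  generalize Dm A (insert a (insert c R)) = d2 at *
  generalize Dm A (insert b (insert c R)) = d3 at *
  generalize Dm A (insert a (insert b (insert c R))) = h at *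
  have z2 : 2 * z = 2 * f0 + d1 + d2 - d3 := by linear_combination q2 + q3 - q1
  have : 4 * (z * z) = (2 * f0 + d1 + d2 - d3) ^ 2 := by rw [← z2]; ring
  linear_combination 4 * J - this

end PartB

section PartC

theorem transfer {σ : Type} [Fintype σ] (Q : MvPolynomial σ ℤ)
    (h : ∀ α : σ → ℚ, (∀ e, α e ≠ 0) → aeval α Q = 0) : Q = 0 := by
  have hinj : Function.Injective (MvPolynomial.map (σ := σ) (Int.castRingHom ℚ)) :=
    MvPolynomial.map_injective _ Int.cast_injective
  apply hinj
  rw [map_zero]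
  have h2 : MvPolynomial.map (Int.castRingHom ℚ) Q * ∏ e : σ, X e = 0 := by
    apply MvPolynomial.funext
    intro x
    rw [map_mul, map_zero, map_prod]
    by_cases hx : ∀ e, x e ≠ 0
    · have := h x hx
      rw [MvPolynomial.eval_map]
      rw [MvPolynomial.aeval_def] at this
      have e1 : (algebraMap ℤ ℚ) = Int.castRingHom ℚ := rfl
      rw [e1] at this
      rw [this, zero_mul]
    · push Not at hx
      obtain ⟨e, he⟩ := hx
      rw [Finset.prod_eq_zero (Finset.mem_univ e), mul_zero]
      simp [he]
  rcases mul_eq_zero.1 h2 with h3 | h3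
  · exact h3
  · exfalso
    rw [Finset.prod_eq_zero_iff] at h3
    obtain ⟨e, _, he⟩ := h3
    exact MvPolynomial.X_ne_zero e he

variable {V : Type} [Fintype V] [DecidableEq V]

open Classical in
noncomputable def Pp (E : Finset (Sym2 V)) (R : Finset V) : MvPolynomial (Sym2 V) ℤ :=
  ∑ F ∈ E.powerset.filter (fun F => Rooted R F), ∏ e ∈ E \ F, X e

-- two trees: one with `a`, the other with `b` and `c`
open Classical in
noncomputable def Ph (E : Finset (Sym2 V)) (R : Finset V) (a b c : V) : MvPolynomial (Sym2 V) ℤ :=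
  ∑ F ∈ E.powerset.filter (fun F => Rooted (insert a (insert b R)) F ∧
    (SimpleGraph.fromEdgeSet (F : Set (Sym2 V))).Reachable b c), ∏ e ∈ E \ F, X e

def yE {K : Type} [Field K] (E : Finset (Sym2 V)) (α : Sym2 V → K) : Sym2 V → K :=
  fun e => if e ∈ E then (α e)⁻¹ else 0

theorem eval_Pp {K : Type} [Field K] (E : Finset (Sym2 V)) (hE : ∀ e ∈ E, ¬ e.IsDiag)
    (R : Finset V) (α : Sym2 V → K) (hα : ∀ e, α e ≠ 0) :
    aeval α (Pp E R) = (∏ e ∈ E, α e) * Dm (lap (yE E α)) R := by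
  classical
  rw [forest_thm R E hE _ (fun e he => by simp [yE, he]), Pp, map_sum, Finset.mul_sum]
  apply Finset.sum_congr rfl
  intro F hF
  simp only [Finset.mem_filter, Finset.mem_powerset] at hF
  rw [map_prod, ← Finset.prod_sdiff hF.1, mul_assoc, ← Finset.prod_mul_distrib]
  simp only [aeval_X]
  rw [Finset.prod_eq_one (s := F), mul_one]
  intro e he
  simp [yE, hF.1 he, hα e]

theorem yE_insert {K : Type} [Field K] (E : Finset (Sym2 V)) (α : Sym2 V → K) (e : Sym2 V) (he : e ∉ E) :
    yE (insert e E) α = fun e' => yE E α e' + if e' = e then (α e)⁻¹ else 0 := by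
  funext e'
  by_cases h : e' = e
  · subst h; simp [yE, he]
  · simp [yE, h]

theorem Pp_edge (E : Finset (Sym2 V)) (hE : ∀ e ∈ E, ¬ e.IsDiag) (R : Finset V) (a b : V)
    (ha : a ∈ R) (hb : b ∉ R) (he : s(a, b) ∉ E) :
    Pp (insert s(a, b) E) R = X s(a, b) * Pp E R + Pp E (insert b R) := by
  have hab : a ≠ b := by rintro rfl; exact hb ha
  rw [← sub_eq_zero]
  apply transfer
  intro α hα
  have hE' : ∀ e ∈ insert s(a, b) E, ¬ e.IsDiag := by
    intro e h
    rcases Finset.mem_insert.1 h with rfl | h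
    · simpa using hab
    · exact hE e h
  rw [map_sub, map_add, map_mul, aeval_X, eval_Pp _ hE' _ _ hα, eval_Pp _ hE _ _ hα, eval_Pp _ hE _ _ hα,
    yE_insert _ _ _ he, lap_edge _ _ _ _ _ ha hb, Finset.prod_insert he]
  field_simp [hα s(a, b)]
  ring

theorem Pp_edge' (E : Finset (Sym2 V)) (hE : ∀ e ∈ E, ¬ e.IsDiag) (R : Finset V) (a b : V)
    (ha : a ∈ R) (hb : b ∈ R) (hab : a ≠ b) (he : s(a, b) ∉ E) :
    Pp (insert s(a, b) E) R = X s(a, b) * Pp E R := by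
  rw [← sub_eq_zero]
  apply transfer
  intro α hα
  have hE' : ∀ e ∈ insert s(a, b) E, ¬ e.IsDiag := by
    intro e h
    rcases Finset.mem_insert.1 h with rfl | h
    · simpa using hab
    · exact hE e h
  rw [map_sub, map_mul, aeval_X, eval_Pp _ hE' _ _ hα, eval_Pp _ hE _ _ hα,
    yE_insert _ _ _ he, lap_edge' _ _ _ _ _ ha hb, Finset.prod_insert he]
  ring

/-- no edge of `E` touches `R` -/
def Iso (E : Finset (Sym2 V)) (R : Finset V) : Prop := ∀ e ∈ E, ∀ r ∈ R, r ∉ e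

theorem Iso.reach {E F : Finset (Sym2 V)} {R : Finset V} (h : Iso E R) (hF : F ⊆ E) {r w : V} (hr : r ∈ R)
    (hre : (SimpleGraph.fromEdgeSet (F : Set (Sym2 V))).Reachable r w) : w = r := by
  refine reach_closed (fun x => x = r) ?_ hre rfl
  rintro x y hxy rfl
  rw [SimpleGraph.fromEdgeSet_adj] at hxy
  exact absurd (Sym2.mem_mk_left x y) (h _ (hF hxy.1) x hr)

theorem Iso.rooted_ne {E F : Finset (Sym2 V)} {R : Finset V} (h : Iso E R) (hF : F ⊆ E) {a : V} (ha : a ∉ R) :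
    ¬ Rooted R F := by
  rintro ⟨_, h2, _⟩
  obtain ⟨r, hr, hre⟩ := h2 a
  have := h.reach hF hr hre.symm
  exact ha (this ▸ hr)

theorem Iso.rooted_swap {E F : Finset (Sym2 V)} {R : Finset V} (h : Iso E R) (hF : F ⊆ E) {a b : V}
    (hb : b ∉ R) (hR : Rooted (insert a R) F) : Rooted (insert b R) F := by
  obtain ⟨h1, h2, h3⟩ := hR
  have hba : (SimpleGraph.fromEdgeSet (F : Set (Sym2 V))).Reachable b a := by
    obtain ⟨r, hr, hre⟩ := h2 b
    rcases Finset.mem_insert.1 hr with rfl | hr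
    · exact hre
    · have := h.reach hF hr hre.symm
      exact absurd (this ▸ hr) hb
  refine ⟨h1, ?_, ?_⟩
  · intro w
    obtain ⟨r, hr, hre⟩ := h2 w
    rcases Finset.mem_insert.1 hr with rfl | hr
    · exact ⟨b, Finset.mem_insert_self _ _, hre.trans hba.symm⟩
    · exact ⟨r, Finset.mem_insert_of_mem hr, hre⟩
  · intro r hr r' hr' hre
    rcases Finset.mem_insert.1 hr with rfl | hr
    · rcases Finset.mem_insert.1 hr' with rfl | hr'
      · rfl
      · exact h.reach hF hr' hre.symm
    · exact (h.reach hF hr hre).symm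

theorem Iso.Pp_zero {E : Finset (Sym2 V)} {R : Finset V} (h : Iso E R) {a : V} (ha : a ∉ R) :
    Pp E R = 0 := by
  classical
  apply Finset.sum_eq_zero
  intro F hF
  simp only [Finset.mem_filter, Finset.mem_powerset] at hF
  exact absurd hF.2 (h.rooted_ne hF.1 ha)

theorem Iso.Pp_swap {E : Finset (Sym2 V)} {R : Finset V} (h : Iso E R) {a b : V} (ha : a ∉ R) (hb : b ∉ R) :
    Pp E (insert a R) = Pp E (insert b R) := by
  classical
  unfold Pp
  congr 1
  apply Finset.filter_congr
  intro F hF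
  rw [Finset.mem_powerset] at hF
  exact ⟨h.rooted_swap hF hb, h.rooted_swap hF ha⟩

theorem Ph_symm {E : Finset (Sym2 V)} {R : Finset V} (h : Iso E R) {a b c : V}
    (hab : a ≠ b) (hac : a ≠ c) (hb : b ∉ R) (hc : c ∉ R) :
    Ph E R a b c = Ph E R a c b := by
  classical
  have key : ∀ F ⊆ E, ∀ b c, a ≠ b → a ≠ c → b ∉ R → c ∉ R → Rooted (insert a (insert b R)) F ∧
    (SimpleGraph.fromEdgeSet (F : Set (Sym2 V))).Reachable b c →
    Rooted (insert a (insert c R)) F ∧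
    (SimpleGraph.fromEdgeSet (F : Set (Sym2 V))).Reachable c b := by
    rintro F hF b c hab hac hb hc ⟨⟨h1, h2, h3⟩, hbc⟩
    have hnab : ¬ (SimpleGraph.fromEdgeSet (F : Set (Sym2 V))).Reachable a b :=
      fun hre => hab (h3 a (by simp) b (by simp) hre)
    refine ⟨⟨h1, ?_, ?_⟩, hbc.symm⟩
    · intro w
      obtain ⟨r, hr, hre⟩ := h2 w
      simp only [Finset.mem_insert] at hr
      rcases hr with rfl | rfl | hr
      · exact ⟨r, by simp, hre⟩
      · exact ⟨c, by simp, hre.trans hbc⟩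
      · exact ⟨r, by simp [hr], hre⟩
    · intro r hr r' hr' hre
      simp only [Finset.mem_insert] at hr hr'
      rcases hr with rfl | rfl | hr
      · rcases hr' with rfl | rfl | hr'
        · rfl
        · exact absurd (hre.trans hbc.symm) hnab
        · exact h.reach hF hr' hre.symm
      · rcases hr' with rfl | rfl | hr'
        · exact absurd (hre.symm.trans hbc.symm) hnab
        · rfl
        · exact h.reach hF hr' hre.symm
      · exact (h.reach hF hr hre).symm
  unfold Ph
  congr 1
  apply Finset.filter_congr
  intro F hF
  rw [Finset.mem_powerset] at hF
  exact ⟨key F hF b c hab hac hb hc, key F hF c b hac hab hc hb⟩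

theorem Pp_split {E : Finset (Sym2 V)} {R : Finset V} (h : Iso E R) {a b c : V}
    (hab : a ≠ b) (hc : c ∉ R) :
    Pp E (insert a (insert b R)) = Ph E R a b c + Ph E R b a c := by
  classical
  unfold Pp Ph
  rw [← Finset.sum_union]
  · congr 1
    ext F
    simp only [Finset.mem_filter, Finset.mem_union, Finset.mem_powerset, Finset.insert_comm b a]
    constructor
    · rintro ⟨hF, h1, h2, h3⟩
      obtain ⟨r, hr, hre⟩ := h2 c
      simp only [Finset.mem_insert] at hr
      rcases hr with rfl | rfl | hr
      · exact Or.inr ⟨hF, ⟨h1, h2, h3⟩, hre.symm⟩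
      · exact Or.inl ⟨hF, ⟨h1, h2, h3⟩, hre.symm⟩
      · have := h.reach hF hr hre.symm
        exact absurd (this ▸ hr) hc
    · rintro (⟨hF, h1, _⟩ | ⟨hF, h1, _⟩) <;> exact ⟨hF, h1⟩
  · rw [Finset.disjoint_left]
    intro F hF hF'
    simp only [Finset.mem_filter, Finset.mem_powerset] at hF hF'
    exact hab (hF.2.1.2.2 a (by simp) b (by simp) (hF'.2.2.trans hF.2.2.symm))

theorem Pp_quad {E : Finset (Sym2 V)} (hE : ∀ e ∈ E, ¬ e.IsDiag) {R : Finset V} (h : Iso E R) {a b c : V}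
    (ha : a ∉ R) (hb : b ∉ R) (hc : c ∉ R) (hab : a ≠ b) (hac : a ≠ c) (hbc : b ≠ c) :
    Pp E (insert a R) * Pp E (insert a (insert b (insert c R))) =
      Ph E R a b c * Ph E R b a c + Ph E R a b c * Ph E R c a b + Ph E R b a c * Ph E R c a b := by
  have s1 := Pp_split (a := a) (b := b) h hab hc
  have s2 := Pp_split (a := a) (b := c) h hac hb
  have s3 := Pp_split (a := b) (b := c) h hbc ha
  rw [← Ph_symm h hab hac hb hc] at s2
  rw [← Ph_symm h hab.symm hbc ha hc, ← Ph_symm h hac.symm hbc.symm ha hb] at s3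
  have h4 : (C 4 : MvPolynomial (Sym2 V) ℤ) ≠ 0 := by simp
  apply mul_left_cancel₀ h4
  have key : C 4 * (Pp E (insert a R) * Pp E (insert a (insert b (insert c R)))) =
      C 2 * (Pp E (insert a (insert b R)) * Pp E (insert a (insert c R)) +
        Pp E (insert a (insert b R)) * Pp E (insert b (insert c R)) +
        Pp E (insert a (insert c R)) * Pp E (insert b (insert c R))) -
      (Pp E (insert a (insert b R)) ^ 2 + Pp E (insert a (insert c R)) ^ 2 +
        Pp E (insert b (insert c R)) ^ 2) := by
    rw [← sub_eq_zero]
    apply transfer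
    intro α hα
    have hb' := congrArg (aeval α) (h.Pp_swap ha hb)
    have hc' := congrArg (aeval α) (h.Pp_swap ha hc)
    have h0' := congrArg (aeval α) (h.Pp_zero ha)
    have hne : (∏ e ∈ E, α e) ≠ 0 := Finset.prod_ne_zero_iff.2 (fun e _ => hα e)
    simp only [eval_Pp _ hE _ _ hα, map_zero, mul_eq_mul_left_iff, hne, or_false, mul_eq_zero, false_or] at hb' hc' h0'
    have q := quad_identity (yE E α) R a b c ha hb hc hab hac hbc ?_ _ h0' rfl hb'.symm hc'.symm
    · simp only [map_sub, map_mul, map_add, map_pow, eval_Pp _ hE _ _ hα, algHom_C]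
      norm_num
      linear_combination (∏ e ∈ E, α e) ^ 2 * q
    · intro r hr x
      unfold yE
      rw [if_neg]
      intro hx
      exact h _ hx r hr (Sym2.mem_mk_right x r)
  rw [key, s1, s2, s3]
  have e4 : (C 4 : MvPolynomial (Sym2 V) ℤ) = 4 := by simp
  have e2 : (C 2 : MvPolynomial (Sym2 V) ℤ) = 2 := by simp
  rw [e4, e2]
  ring

theorem Pp_totalDegree {E : Finset (Sym2 V)} (hE : ∀ e ∈ E, ¬ e.IsDiag) (R : Finset V) :
    (Pp E R).totalDegree ≤ E.card - (Fintype.card V - R.card) := by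
  classical
  apply MvPolynomial.totalDegree_finsetSum_le
  intro F hF
  simp only [Finset.mem_filter, Finset.mem_powerset] at hF
  refine (MvPolynomial.totalDegree_finsetProd _ _).trans ?_
  simp only [totalDegree_X, Finset.sum_const, smul_eq_mul, mul_one]
  rw [Finset.card_sdiff_of_subset hF.1, hF.2.card (fun e he => hE e (hF.1 he))]

theorem Ph_totalDegree {E : Finset (Sym2 V)} (hE : ∀ e ∈ E, ¬ e.IsDiag) (R : Finset V) (a b c : V)
    (hab : a ≠ b) (ha : a ∉ R) (hb : b ∉ R) :
    (Ph E R a b c).totalDegree ≤ E.card - (Fintype.card V - (R.card + 2)) := by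
  classical
  apply MvPolynomial.totalDegree_finsetSum_le
  intro F hF
  simp only [Finset.mem_filter, Finset.mem_powerset] at hF
  refine (MvPolynomial.totalDegree_finsetProd _ _).trans ?_
  simp only [totalDegree_X, Finset.sum_const, smul_eq_mul, mul_one]
  rw [Finset.card_sdiff_of_subset hF.1, hF.2.1.card (fun e he => hE e (hF.1 he)),
    Finset.card_insert_of_notMem (by simp [hab, ha]), Finset.card_insert_of_notMem hb]

theorem Pp_congr {K : Type} [CommRing K] (E : Finset (Sym2 V)) (R : Finset V) (x y : Sym2 V → K)
    (h : ∀ e ∈ E, x e = y e) : aeval x (Pp E R) = aeval y (Pp E R) := by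
  classical
  unfold Pp
  simp only [map_sum, map_prod, aeval_X]
  apply Finset.sum_congr rfl
  intro F _
  apply Finset.prod_congr rfl
  intro e he
  exact h e (Finset.mem_sdiff.1 he).1

theorem Ph_congr {K : Type} [CommRing K] (E : Finset (Sym2 V)) (R : Finset V) (a b c : V) (x y : Sym2 V → K)
    (h : ∀ e ∈ E, x e = y e) : aeval x (Ph E R a b c) = aeval y (Ph E R a b c) := by
  classical
  unfold Ph
  simp only [map_sum, map_prod, aeval_X]
  apply Finset.sum_congr rfl
  intro F _
  apply Finset.prod_congr rfl
  intro e he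
  exact h e (Finset.mem_sdiff.1 he).1

end PartC

section PartD
variable {σ : Type} [Fintype σ] [DecidableEq σ] {K : Type} [Field K] [Fintype K] [DecidableEq K]

def SS (K : Type) [Field K] [Fintype K] (E : Finset σ) : Finset (σ → K) :=
  Fintype.piFinset (fun e => if e ∈ E then Finset.univ else {0})

theorem mem_SS {E : Finset σ} {x : σ → K} : x ∈ SS K E ↔ ∀ e ∉ E, x e = 0 := by
  unfold SS
  rw [Fintype.mem_piFinset]
  constructor
  · intro h e he
    have := h e
    simpa [he] using this
  · intro h e
    by_cases he : e ∈ E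
    · simp [he]
    · simp [he, h e he]

theorem card_SS (E : Finset σ) : (SS K E).card = Fintype.card K ^ E.card := by
  unfold SS
  rw [Fintype.card_piFinset]
  have : ∀ e, (if e ∈ E then (Finset.univ : Finset K) else {0}).card = if e ∈ E then Fintype.card K else 1 := by
    intro e
    split_ifs <;> simp
  simp only [this]
  simp [Finset.prod_ite]

theorem sum_SS_insert {M : Type} [AddCommMonoid M] {E : Finset σ} {e : σ} (he : e ∉ E) (f : (σ → K) → M) :
    ∑ x ∈ SS K (insert e E), f x = ∑ x ∈ SS K E, ∑ t : K, f (Function.update x e t) := by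
  rw [← Finset.sum_product']
  refine Finset.sum_bij' (fun x _ => (Function.update x e 0, x e)) (fun y _ => Function.update y.1 e y.2) ?_ ?_ ?_ ?_ ?_
  · intro x hx
    rw [Finset.mem_product]
    refine ⟨?_, Finset.mem_univ _⟩
    rw [mem_SS] at hx ⊢
    intro i hi
    by_cases h : i = e
    · subst h; simp
    · simp only [Function.update_of_ne h]
      exact hx i (by simp [h, hi])
  · intro y hy
    rw [Finset.mem_product] at hy
    have := hy.1
    rw [mem_SS] at this ⊢
    intro i hi
    simp only [Finset.mem_insert, not_or] at hi
    rw [Function.update_of_ne hi.1]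
    exact this i hi.2
  · intro x hx
    simp
  · intro y hy
    rw [Finset.mem_product] at hy
    have := mem_SS.1 hy.1 e he
    ext i
    · by_cases h : i = e
      · subst h; simp [this]
      · simp [h]
    · simp
  · intro x hx
    simp

def cnt (E : Finset σ) (P : (σ → K) → Prop) [DecidablePred P] : ℕ := ((SS K E).filter P).card

theorem cnt_eq_sum (E : Finset σ) (P : (σ → K) → Prop) [DecidablePred P] :
    cnt E P = ∑ x ∈ SS K E, if P x then 1 else 0 := by
  rw [cnt, Finset.card_filter]

theorem cnt_insert {E : Finset σ} {e : σ} (he : e ∉ E) (P : (σ → K) → Prop) [DecidablePred P] :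
    cnt (insert e E) P = ∑ x ∈ SS K E, ∑ t : K, if P (Function.update x e t) then 1 else 0 := by
  rw [cnt_eq_sum, sum_SS_insert he]

theorem cnt_congr (E : Finset σ) {P Q : (σ → K) → Prop} [DecidablePred P] [DecidablePred Q]
    (h : ∀ x, P x ↔ Q x) : cnt E P = cnt E Q := by
  unfold cnt
  congr 1
  exact Finset.filter_congr (fun x _ => h x)

theorem aeval_sum' (Q : MvPolynomial σ ℤ) (x : σ → K) :
    aeval x Q = ∑ d ∈ Q.support, ((Q.coeff d : ℤ) : K) * ∏ i, x i ^ d i := by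
  rw [MvPolynomial.aeval_def, MvPolynomial.eval₂_eq']
  rfl

theorem sum_mono (E : Finset σ) (d : σ →₀ ℕ) :
    ∑ x ∈ SS K E, ∏ i, x i ^ d i = ∏ i, ∑ t ∈ (if i ∈ E then (Finset.univ : Finset K) else {0}), t ^ d i := by
  unfold SS
  rw [Finset.prod_univ_sum]

theorem sum_mono_zero (E : Finset σ) (d : σ →₀ ℕ) {i : σ} (hi : i ∈ E) (h : d i < Fintype.card K - 1) :
    ∑ x ∈ SS K E, ∏ i, x i ^ d i = 0 := by
  rw [sum_mono]
  apply Finset.prod_eq_zero (Finset.mem_univ i)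
  rw [if_pos hi]
  exact FiniteField.sum_pow_lt_card_sub_one K _ h

theorem sum_E_le (Q : MvPolynomial σ ℤ) {d : σ →₀ ℕ} (hd : d ∈ Q.support) :
    ∑ i, d i ≤ Q.totalDegree := by
  have := MvPolynomial.le_totalDegree hd
  rwa [Finsupp.sum_fintype _ _ (fun _ => rfl)] at this

theorem sum_aeval_zero (E : Finset σ) (Q : MvPolynomial σ ℤ)
    (h : Q.totalDegree < E.card * (Fintype.card K - 1)) :
    ∑ x ∈ SS K E, aeval x Q = 0 := by
  simp only [aeval_sum']
  rw [Finset.sum_comm]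
  apply Finset.sum_eq_zero
  intro d hd
  rw [← Finset.mul_sum]
  have h1 := sum_E_le Q hd
  have : ∃ i ∈ E, d i < Fintype.card K - 1 := by
    by_contra hcon
    push Not at hcon
    have h2 := Finset.card_nsmul_le_sum E (fun i => d i) _ hcon
    have h3 : ∑ i ∈ E, d i ≤ ∑ i, d i := Finset.sum_le_univ_sum_of_nonneg (fun _ => Nat.zero_le _)
    simp only [smul_eq_mul] at h2
    omega
  obtain ⟨i, hi, hlt⟩ := this
  rw [sum_mono_zero E d hi hlt, mul_zero]

noncomputable def dE (E : Finset σ) (k : ℕ) : σ →₀ ℕ := Finsupp.equivFunOnFinite.symm fun e => if e ∈ E then k else 0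

theorem sum_aeval_top (E : Finset σ) (Q : MvPolynomial σ ℤ)
    (h : Q.totalDegree ≤ E.card * (Fintype.card K - 1)) :
    ∑ x ∈ SS K E, aeval x Q = (-1) ^ E.card * ((Q.coeff (dE E (Fintype.card K - 1)) : ℤ) : K) := by
  simp only [aeval_sum']
  rw [Finset.sum_comm]
  simp only [← Finset.mul_sum]
  have hq : 1 < Fintype.card K := Fintype.one_lt_card
  have hval : ∑ x ∈ SS K E, ∏ i, x i ^ (dE E (Fintype.card K - 1)) i = (-1) ^ E.card := by
    rw [sum_mono]
    have : ∀ i, (∑ t ∈ (if i ∈ E then (Finset.univ : Finset K) else {0}), t ^ (dE E (Fintype.card K - 1)) i)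
        = if i ∈ E then -1 else 1 := by
      intro i
      by_cases hi : i ∈ E
      · simp only [hi, if_true, dE, Finsupp.equivFunOnFinite_symm_apply_apply]
        have h1 : ∀ t : K, t ^ (Fintype.card K - 1) = 1 - if t = 0 then 1 else 0 := by
          intro t
          by_cases ht : t = 0
          · subst ht; rw [zero_pow (by omega)]; simp
          · rw [FiniteField.pow_card_sub_one_eq_one t ht]; simp [ht]
        simp only [h1, Finset.sum_sub_distrib]
        simp
      · simp [hi, dE]
    simp only [this]
    simp [Finset.prod_ite]
  rw [Finset.sum_eq_single (dE E (Fintype.card K - 1))]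
  · rw [hval, mul_comm]
  · intro d hd hne
    have h1 := sum_E_le Q hd
    have : ∃ i ∈ E, d i < Fintype.card K - 1 := by
      by_contra hcon
      push Not at hcon
      apply hne
      have h2 := Finset.card_nsmul_le_sum E (fun i => d i) _ hcon
      simp only [smul_eq_mul] at h2
      have h3 : ∑ i ∈ E, d i + ∑ i ∈ Eᶜ, d i = ∑ i, d i := Finset.sum_add_sum_compl E d
      have h4 : ∑ i ∈ Eᶜ, d i = 0 := by omega
      have h5 : ∑ i ∈ E, (Fintype.card K - 1) = ∑ i ∈ E, d i := by
        rw [Finset.sum_const, smul_eq_mul]; omega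
      ext i
      by_cases hi : i ∈ E
      · simp only [dE, Finsupp.equivFunOnFinite_symm_apply_apply, hi, if_true]
        exact ((Finset.sum_eq_sum_iff_of_le hcon).1 h5 i hi).symm
      · simp only [dE, Finsupp.equivFunOnFinite_symm_apply_apply, hi, if_false]
        exact (Finset.sum_eq_zero_iff.1 h4) i (by simp [hi])
    obtain ⟨i, hi, hlt⟩ := this
    rw [sum_mono_zero E d hi hlt, mul_zero]
  · intro hns
    rw [MvPolynomial.notMem_support_iff.1 hns]
    simp

theorem ind_pow (t : K) : (if t = 0 then (1 : K) else 0) = 1 - t ^ (Fintype.card K - 1) := by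
  have hq : 1 < Fintype.card K := Fintype.one_lt_card
  by_cases ht : t = 0
  · subst ht; rw [zero_pow (by omega)]; simp
  · rw [FiniteField.pow_card_sub_one_eq_one t ht]; simp [ht]

theorem deg_one_sub_pow (f : MvPolynomial σ ℤ) (k : ℕ) :
    (1 - f ^ k).totalDegree ≤ f.totalDegree * k := by
  refine (MvPolynomial.totalDegree_sub _ _).trans ?_
  rw [MvPolynomial.totalDegree_one]
  have := MvPolynomial.totalDegree_pow f k
  rw [mul_comm]
  simpa using this

theorem CW2 (E : Finset σ) (f g : MvPolynomial σ ℤ) (h : f.totalDegree + g.totalDegree < E.card) :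
    ((cnt E (fun x : σ → K => aeval x f = 0 ∧ aeval x g = 0) : ℕ) : K) = 0 := by
  have hq : 1 < Fintype.card K := Fintype.one_lt_card
  rw [cnt_eq_sum]
  push_cast
  have : ∀ x : σ → K, (if aeval x f = 0 ∧ aeval x g = 0 then (1 : K) else 0) =
      aeval x ((1 - f ^ (Fintype.card K - 1)) * (1 - g ^ (Fintype.card K - 1))) := by
    intro x
    simp only [map_mul, map_sub, map_one, map_pow, ← ind_pow]
    by_cases h1 : aeval x f = 0 <;> by_cases h2 : aeval x g = 0 <;> simp [h1, h2]
  simp only [this]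
  apply sum_aeval_zero
  refine (MvPolynomial.totalDegree_mul _ _).trans_lt ?_
  have h1 := deg_one_sub_pow f (Fintype.card K - 1)
  have h2 := deg_one_sub_pow g (Fintype.card K - 1)
  calc _ ≤ (f.totalDegree + g.totalDegree) * (Fintype.card K - 1) := by rw [add_mul]; omega
    _ < _ := Nat.mul_lt_mul_of_pos_right h (by omega)

theorem CW1 (E : Finset σ) (f : MvPolynomial σ ℤ) (h : f.totalDegree < E.card) :
    ((cnt E (fun x : σ → K => aeval x f = 0) : ℕ) : K) = 0 := by
  have := CW2 (K := K) E f 0 (by simpa using h)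
  simpa using this

theorem CW3 (E : Finset σ) (f : MvPolynomial σ ℤ) (h : f.totalDegree ≤ E.card) (hE : 0 < E.card) :
    ((cnt E (fun x : σ → K => aeval x f = 0) : ℕ) : K) =
      - ((-1) ^ E.card * (((f ^ (Fintype.card K - 1)).coeff (dE E (Fintype.card K - 1)) : ℤ) : K)) := by
  have hq : 1 < Fintype.card K := Fintype.one_lt_card
  rw [cnt_eq_sum]
  push_cast
  have : ∀ x : σ → K, (if aeval x f = 0 then (1 : K) else 0) =
      aeval x (1 : MvPolynomial σ ℤ) - aeval x (f ^ (Fintype.card K - 1)) := by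
    intro x
    simp only [map_one, map_pow, ← ind_pow]
  simp only [this, Finset.sum_sub_distrib]
  rw [sum_aeval_zero E 1, sum_aeval_top E (f ^ (Fintype.card K - 1)), zero_sub]
  · refine (MvPolynomial.totalDegree_pow _ _).trans ?_
    rw [mul_comm]
    exact Nat.mul_le_mul_right _ h
  · rw [MvPolynomial.totalDegree_one]
    exact Nat.mul_pos hE (by omega)

end PartD

section PartE
variable {K : Type} [Field K] [Fintype K] [DecidableEq K]

theorem lin_count (u w : K) (m : ℕ) :
    (∑ t : K, if t * u + w = 0 then m else 0) =
      if u ≠ 0 then m else if w = 0 then Fintype.card K * m else 0 := by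
  by_cases hu : u = 0
  · subst hu
    by_cases hw : w = 0 <;> simp [hw]
  · simp only [ne_eq, hu, not_false_eq_true, if_true]
    have : ∀ t : K, (t * u + w = 0) ↔ t = -w / u := by
      intro t
      rw [eq_div_iff hu]
      constructor
      · intro h; linear_combination h
      · intro h; linear_combination h
    simp only [this]
    simp

theorem sum_ite_one (r : K) (A : ℕ) : (∑ t : K, if t = r then A else 1) + 1 = A + Fintype.card K := by
  have : ∀ t : K, (if t = r then A else 1) + (if t = r then 1 else 0) = (if t = r then A else 0) + 1 := by
    intro t; split_ifs <;> omega
  have h2 := Finset.sum_congr (rfl : (Finset.univ : Finset K) = Finset.univ) (fun t _ => this t)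
  rw [Finset.sum_add_distrib, Finset.sum_add_distrib] at h2
  simpa using h2

theorem field_count (f0 f1 f2 f3 h : K) (hq : f0 * h = f1 * f2 + f1 * f3 + f2 * f3) :
    (∑ t3 : K, ∑ t2 : K, ∑ t1 : K,
      if f0 * (t1 * t2 + t1 * t3 + t2 * t3) + t1 * (f2 + f3) + t2 * (f1 + f3) + t3 * (f1 + f2) + h = 0 then 1 else 0)
      + (if f0 = 0 ∧ f1 = 0 ∧ f2 = 0 ∧ f3 = 0 then Fintype.card K ^ 2 else 0) =
    Fintype.card K ^ 2 + (if (f0 = 0 ∧ f1 = 0 ∧ f2 = 0 ∧ f3 = 0) ∧ h = 0 then Fintype.card K ^ 3 else 0) := by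
  have e1 : ∀ t1 t2 t3 : K, f0 * (t1 * t2 + t1 * t3 + t2 * t3) + t1 * (f2 + f3) + t2 * (f1 + f3) + t3 * (f1 + f2) + h
    = t1 * (f0 * (t2 + t3) + (f2 + f3)) + (f0 * (t2 * t3) + t2 * (f1 + f3) + t3 * (f1 + f2) + h) := by
    intros; ring
  simp only [e1, lin_count]
  by_cases h0 : f0 = 0
  · subst h0
    simp only [zero_mul, zero_add, true_and] at hq ⊢
    by_cases D1 : f2 + f3 = 0
    · simp only [D1, ne_eq, not_true_eq_false, if_false]
      have e2 : ∀ t2 t3 : K, t2 * (f1 + f3) + t3 * (f1 + f2) + h = t2 * (f1 + f3) + (t3 * (f1 + f2) + h) := by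
        intros; ring
      simp only [e2, lin_count]
      by_cases D2 : f1 + f3 = 0
      · simp only [D2, ne_eq, not_true_eq_false, if_false, lin_count]
        by_cases D3 : f1 + f2 = 0
        · have g1 : f1 = 0 := by
            have a1 : f2 = -f1 := by linear_combination D3
            have a2 : f3 = -f1 := by linear_combination D2
            rw [a1, a2] at hq
            have : f1 ^ 2 = 0 := by linear_combination hq
            exact pow_eq_zero_iff (two_ne_zero) |>.1 this
          have g2 : f2 = 0 := by linear_combination D3 - g1
          have g3 : f3 = 0 := by linear_combination D2 - g1
          subst g1 g2 g3
          by_cases hh : h = 0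
          · simp [hh]; ring
          · simp [hh]
        · have : ¬ (f1 = 0 ∧ f2 = 0 ∧ f3 = 0) := by
            rintro ⟨g1, g2, g3⟩; exact D3 (by rw [g1, g2, add_zero])
          simp [D3, this]; ring
      · have : ¬ (f1 = 0 ∧ f2 = 0 ∧ f3 = 0) := by
          rintro ⟨g1, g2, g3⟩; exact D2 (by rw [g1, g3, add_zero])
        simp [D2, this]; ring
    · have : ¬ (f1 = 0 ∧ f2 = 0 ∧ f3 = 0) := by
        rintro ⟨g1, g2, g3⟩; exact D1 (by rw [g2, g3, add_zero])
      simp [D1, this]; ring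
  · have e3 : ∀ t2 t3 : K, (if f0 * (t2 + t3) + (f2 + f3) ≠ 0 then 1 else
        if f0 * (t2 * t3) + t2 * (f1 + f3) + t3 * (f1 + f2) + h = 0 then Fintype.card K * 1 else 0) =
        if t2 = -(f2 + f3) / f0 - t3 then (if t3 = -f3 / f0 then Fintype.card K else 0) else 1 := by
      intro t2 t3
      have i1 : f0 * (t2 + t3) + (f2 + f3) = 0 ↔ t2 = -(f2 + f3) / f0 - t3 := by
        rw [eq_sub_iff_add_eq, eq_div_iff h0]
        constructor
        · intro h; linear_combination h
        · intro h; linear_combination h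
      by_cases hc : f0 * (t2 + t3) + (f2 + f3) = 0
      · have i2 : f0 * (t2 * t3) + t2 * (f1 + f3) + t3 * (f1 + f2) + h = 0 ↔ t3 = -f3 / f0 := by
          rw [eq_div_iff h0]
          have key : f0 * (f0 * (t2 * t3) + t2 * (f1 + f3) + t3 * (f1 + f2) + h) = -(f0 * t3 + f3) ^ 2 := by
            linear_combination hq + (f0 * t3 + f1 + f3) * hc
          constructor
          · intro h1
            rw [h1, mul_zero] at key
            have : (f0 * t3 + f3) ^ 2 = 0 := by linear_combination key
            have := pow_eq_zero_iff (two_ne_zero) |>.1 this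
            linear_combination this
          · intro h1
            have : f0 * t3 + f3 = 0 := by linear_combination h1
            rw [this] at key
            simpa [h0] using key
        rw [if_neg (by simpa using hc), if_pos (i1.1 hc), mul_one]
        simp only [i2]
      · rw [if_pos hc, if_neg (fun h => hc (i1.2 h))]
    simp only [e3]
    have s1 : ∀ t3 : K, (∑ t2 : K, if t2 = -(f2 + f3) / f0 - t3 then (if t3 = -f3 / f0 then Fintype.card K else 0) else 1) + 1 =
      (if t3 = -f3 / f0 then Fintype.card K else 0) + Fintype.card K := fun t3 => sum_ite_one _ _
    have s2 := Finset.sum_congr (rfl : (Finset.univ : Finset K) = Finset.univ) (fun t _ => s1 t)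
    rw [Finset.sum_add_distrib, Finset.sum_add_distrib] at s2
    simp only [Finset.sum_ite_eq', Finset.mem_univ, if_true, Finset.sum_const, Finset.card_univ, smul_eq_mul, mul_one] at s2
    simp only [h0, false_and, if_false, add_zero]
    rw [sq]
    omega

variable {V : Type} [Fintype V] [DecidableEq V]

theorem nd_insert {E : Finset (Sym2 V)} (hE : ∀ e ∈ E, ¬ e.IsDiag) {a b : V} (hab : a ≠ b) :
    ∀ e ∈ insert s(a, b) E, ¬ e.IsDiag := by
  intro e h
  rcases Finset.mem_insert.1 h with rfl | h
  · simpa using hab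
  · exact hE e h

theorem expand2 {E : Finset (Sym2 V)} (hE : ∀ e ∈ E, ¬ e.IsDiag) {R : Finset V} {v b c : V}
    (hv : v ∈ R) (hb : b ∉ R) (hc : c ∉ R) (hbc : b ≠ c)
    (h2 : s(v, b) ∉ E) (h3 : s(v, c) ∉ E) :
    Pp (insert s(v, b) (insert s(v, c) E)) R =
      X s(v, b) * X s(v, c) * Pp E R + X s(v, b) * Pp E (insert c R) + X s(v, c) * Pp E (insert b R)
        + Pp E (insert c (insert b R)) := by
  have hvb : v ≠ b := by rintro rfl; exact hb hv
  have hvc : v ≠ c := by rintro rfl; exact hc hv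
  have hne : s(v, b) ∉ insert s(v, c) E := by
    simp only [Finset.mem_insert, Sym2.eq_iff, not_or]
    exact ⟨by tauto, h2⟩
  rw [Pp_edge _ (nd_insert hE hvc) _ _ _ hv hb hne, Pp_edge _ hE _ _ _ hv hc h3,
    Pp_edge _ hE _ _ _ (Finset.mem_insert_of_mem hv) (by simp [hc, hbc.symm]) h3]
  ring

theorem expand3 {E : Finset (Sym2 V)} (hE : ∀ e ∈ E, ¬ e.IsDiag) {R : Finset V} {v a b c : V}
    (hv : v ∈ R) (ha : a ∉ R) (hb : b ∉ R) (hc : c ∉ R) (hab : a ≠ b) (hac : a ≠ c) (hbc : b ≠ c)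
    (hI : Iso E R) :
    Pp (insert s(v, a) (insert s(v, b) (insert s(v, c) E))) R =
      Pp E (insert a R) * (X s(v, a) * X s(v, b) + X s(v, a) * X s(v, c) + X s(v, b) * X s(v, c)) +
      X s(v, a) * (Ph E R b a c + Ph E R c a b) + X s(v, b) * (Ph E R a b c + Ph E R c a b) +
      X s(v, c) * (Ph E R a b c + Ph E R b a c) + Pp E (insert a (insert b (insert c R))) := by
  have hvb : v ≠ b := by rintro rfl; exact hb hv
  have hvc : v ≠ c := by rintro rfl; exact hc hv
  have hva : v ≠ a := by rintro rfl; exact ha hv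
  have n : ∀ x, s(v, x) ∉ E := fun x hx => hI _ hx v hv (Sym2.mem_mk_left v x)
  have hne : s(v, a) ∉ insert s(v, b) (insert s(v, c) E) := by
    simp only [Finset.mem_insert, Sym2.eq_iff, not_or]
    exact ⟨by tauto, by tauto, n a⟩
  have s1 := Pp_split (a := a) (b := b) hI hab hc
  have s2 := Pp_split (a := a) (b := c) hI hac hb
  have s3 := Pp_split (a := b) (b := c) hI hbc ha
  rw [← Ph_symm hI hab hac hb hc] at s2
  rw [← Ph_symm hI hab.symm hbc ha hc, ← Ph_symm hI hac.symm hbc.symm ha hb] at s3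
  rw [Pp_edge _ (nd_insert (nd_insert hE hvc) hvb) _ _ _ hv ha hne, expand2 hE hv hb hc hbc (n b) (n c),
    expand2 hE (Finset.mem_insert_of_mem hv) (by simp [hb, hab.symm]) (by simp [hc, hac.symm]) hbc (n b) (n c),
    hI.Pp_zero ha, ← hI.Pp_swap ha hc, ← hI.Pp_swap ha hb, Finset.insert_comm c b R, s3,
    Finset.insert_comm c a R, s2, Finset.insert_comm b a R, s1, Finset.insert_comm c a,
    Finset.insert_comm c b R]
  ring

theorem ML {E : Finset (Sym2 V)} (hE : ∀ e ∈ E, ¬ e.IsDiag) {R : Finset V} {v a b c : V}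
    (hv : v ∈ R) (ha : a ∉ R) (hb : b ∉ R) (hc : c ∉ R) (hab : a ≠ b) (hac : a ≠ c) (hbc : b ≠ c)
    (hI : Iso E R) :
    cnt (insert s(v, a) (insert s(v, b) (insert s(v, c) E)))
      (fun x : Sym2 V → K => aeval x (Pp (insert s(v, a) (insert s(v, b) (insert s(v, c) E))) R) = 0)
     + Fintype.card K ^ 2 * cnt E (fun x : Sym2 V → K => aeval x (Pp E (insert a R)) = 0 ∧ aeval x (Ph E R a b c) = 0 ∧
        aeval x (Ph E R b a c) = 0 ∧ aeval x (Ph E R c a b) = 0) =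
     Fintype.card K ^ 2 * Fintype.card K ^ E.card + Fintype.card K ^ 3 *
      cnt E (fun x : Sym2 V → K => (aeval x (Pp E (insert a R)) = 0 ∧ aeval x (Ph E R a b c) = 0 ∧
        aeval x (Ph E R b a c) = 0 ∧ aeval x (Ph E R c a b) = 0) ∧ aeval x (Pp E (insert a (insert b (insert c R)))) = 0) := by
  have hvb : v ≠ b := by rintro rfl; exact hb hv
  have hvc : v ≠ c := by rintro rfl; exact hc hv
  have hva : v ≠ a := by rintro rfl; exact ha hv
  have n : ∀ x, s(v, x) ∉ E := fun x hx => hI _ hx v hv (Sym2.mem_mk_left v x)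
  have m1 : s(v, a) ≠ s(v, b) := by rw [ne_eq, Sym2.eq_iff]; tauto
  have m2 : s(v, a) ≠ s(v, c) := by rw [ne_eq, Sym2.eq_iff]; tauto
  have m3 : s(v, b) ≠ s(v, c) := by rw [ne_eq, Sym2.eq_iff]; tauto
  rw [cnt_insert (by simp [m1, m2, n]), sum_SS_insert (by simp [m3, n]), sum_SS_insert (n c)]
  rw [cnt_eq_sum, cnt_eq_sum, Finset.mul_sum, Finset.mul_sum, ← card_SS (K := K) E, mul_comm _ (SS K E).card,
    ← smul_eq_mul (SS K E).card, ← Finset.sum_const, ← Finset.sum_add_distrib, ← Finset.sum_add_distrib]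
  apply Finset.sum_congr rfl
  intro x _
  have hq := congrArg (aeval x) (Pp_quad hE hI ha hb hc hab hac hbc)
  simp only [map_mul, map_add] at hq
  have := field_count _ _ _ _ _ hq
  simp only [mul_ite, mul_one, mul_zero]
  rw [← this]
  congr 1
  apply Finset.sum_congr rfl; intro t3 _
  apply Finset.sum_congr rfl; intro t2 _
  apply Finset.sum_congr rfl; intro t1 _
  rw [expand3 hE hv ha hb hc hab hac hbc hI]
  have hag : ∀ e ∈ E, Function.update (Function.update (Function.update x s(v, c) t3) s(v, b) t2) s(v, a) t1 e = x e := by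
    intro e he
    have hn : ∀ y, e ≠ s(v, y) := fun y h => n y (h ▸ he)
    simp [Function.update_of_ne (hn _)]
  simp only [map_add, map_mul, aeval_X, Pp_congr E _ _ _ hag, Ph_congr E _ _ _ _ _ _ hag]
  simp [m1, m2, m3, m1.symm, m2.symm, m3.symm]

theorem ML_dvd {E : Finset (Sym2 V)} (hE : ∀ e ∈ E, ¬ e.IsDiag) {R : Finset V} {v a b c : V}
    (hv : v ∈ R) (ha : a ∉ R) (hb : b ∉ R) (hc : c ∉ R) (hab : a ≠ b) (hac : a ≠ c) (hbc : b ≠ c)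
    (hI : Iso E R) :
    Fintype.card K ^ 2 ∣ cnt (insert s(v, a) (insert s(v, b) (insert s(v, c) E)))
      (fun x : Sym2 V → K => aeval x (Pp (insert s(v, a) (insert s(v, b) (insert s(v, c) E))) R) = 0) := by
  have := ML (K := K) hE hv ha hb hc hab hac hbc hI
  rw [← Nat.dvd_add_left (Dvd.intro _ rfl), this]
  apply dvd_add (Dvd.intro _ rfl)
  exact Dvd.dvd.mul_right (pow_dvd_pow _ (by norm_num)) _

end PartE

section PartF
variable {K : Type} [Field K] [Fintype K] [DecidableEq K]
variable {V : Type} [Fintype V] [DecidableEq V]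

theorem card_cast_zero : ((Fintype.card K : ℕ) : K) = 0 := by
  simp

theorem star2 {E : Finset (Sym2 V)} (hE : ∀ e ∈ E, ¬ e.IsDiag) {v c : V} (hI : Iso E {v})
    (hd : (E.filter (fun e => c ∈ e)).card = 2) :
    ∃ d1 d2, d1 ≠ d2 ∧ d1 ≠ c ∧ d2 ≠ c ∧ d1 ≠ v ∧ d2 ≠ v ∧
      E = insert s(c, d1) (insert s(c, d2) (E.filter (fun e => c ∉ e))) := by
  obtain ⟨e1, e2, hne, he⟩ := Finset.card_eq_two.1 hd
  have key : ∀ e ∈ E.filter (fun e => c ∈ e), ∃ d, e = s(c, d) ∧ d ≠ c ∧ d ≠ v := by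
    intro e he
    rw [Finset.mem_filter] at he
    obtain ⟨h1, d, rfl⟩ := he
    refine ⟨d, rfl, ?_, ?_⟩
    · rintro rfl; exact hE _ h1 rfl
    · rintro rfl; exact hI _ h1 d (by simp) (Sym2.mem_mk_right _ _)
  obtain ⟨d1, rfl, h11, h12⟩ := key e1 (by simp [he])
  obtain ⟨d2, rfl, h21, h22⟩ := key e2 (by simp [he])
  refine ⟨d1, d2, by rintro rfl; exact hne rfl, h11, h21, h12, h22, ?_⟩
  conv_lhs => rw [← Finset.filter_union_filter_not_eq (fun e => c ∈ e) E, he]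
  ext e; simp [or_assoc]

theorem star3 {E : Finset (Sym2 V)} (hE : ∀ e ∈ E, ¬ e.IsDiag) {v c : V} (hI : Iso E {v})
    (hd : (E.filter (fun e => c ∈ e)).card = 3) :
    ∃ d1 d2 d3, d1 ≠ d2 ∧ d1 ≠ d3 ∧ d2 ≠ d3 ∧ d1 ≠ c ∧ d2 ≠ c ∧ d3 ≠ c ∧ d1 ≠ v ∧ d2 ≠ v ∧ d3 ≠ v ∧
      E = insert s(c, d1) (insert s(c, d2) (insert s(c, d3) (E.filter (fun e => c ∉ e)))) := by
  obtain ⟨e1, e2, e3, hne, hne2, hne3, he⟩ := Finset.card_eq_three.1 hd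
  have key : ∀ e ∈ E.filter (fun e => c ∈ e), ∃ d, e = s(c, d) ∧ d ≠ c ∧ d ≠ v := by
    intro e he
    rw [Finset.mem_filter] at he
    obtain ⟨h1, d, rfl⟩ := he
    refine ⟨d, rfl, ?_, ?_⟩
    · rintro rfl; exact hE _ h1 rfl
    · rintro rfl; exact hI _ h1 d (by simp) (Sym2.mem_mk_right _ _)
  obtain ⟨d1, rfl, h11, h12⟩ := key e1 (by simp [he])
  obtain ⟨d2, rfl, h21, h22⟩ := key e2 (by simp [he])
  obtain ⟨d3, rfl, h31, h32⟩ := key e3 (by simp [he])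
  refine ⟨d1, d2, d3, by rintro rfl; exact hne rfl, by rintro rfl; exact hne2 rfl,
    by rintro rfl; exact hne3 rfl, h11, h21, h31, h12, h22, h32, ?_⟩
  conv_lhs => rw [← Finset.filter_union_filter_not_eq (fun e => c ∈ e) E, he]
  ext e; simp [or_assoc]

theorem step3_adj {E : Finset (Sym2 V)} (hE : ∀ e ∈ E, ¬ e.IsDiag) {v a b : V}
    (hav : a ≠ v) (hbv : b ≠ v) (hab : a ≠ b)
    (hcard : E.card + 5 = 2 * Fintype.card V) (hn : 4 ≤ Fintype.card V)
    (hadj : s(a, b) ∈ E) :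
    ((cnt E (fun x : Sym2 V → K => aeval x (Pp E (insert a {v})) = 0 ∧ aeval x (Pp E (insert a (insert b {v}))) = 0) : ℕ) : K) = 0 := by
  obtain ⟨E', hE', rfl⟩ : ∃ E', s(a, b) ∉ E' ∧ E = insert s(a, b) E' :=
    ⟨E.erase s(a, b), by simp, by rw [Finset.insert_erase hadj]⟩
  have hE0 : ∀ e ∈ E', ¬ e.IsDiag := fun e he => hE e (Finset.mem_insert_of_mem he)
  rw [Finset.card_insert_of_notMem hE'] at hcard
  set A := Pp E' (insert a {v}) with hA
  set B := Pp E' (insert a (insert b {v})) with hB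
  have dA : A.totalDegree ≤ E'.card - (Fintype.card V - 2) := by
    have := Pp_totalDegree hE0 (insert a {v})
    rwa [Finset.card_insert_of_notMem (by simpa using hav), Finset.card_singleton] at this
  have dB : B.totalDegree ≤ E'.card - (Fintype.card V - 3) := by
    have := Pp_totalDegree hE0 (insert a (insert b {v}))
    rwa [Finset.card_insert_of_notMem (by simp [hav, hab]), Finset.card_insert_of_notMem (by simpa using hbv), Finset.card_singleton] at this
  have c1 := CW1 (K := K) E' B (by omega)
  have c2 := CW2 (K := K) E' A B (by omega)
  rw [Pp_edge _ hE0 _ _ _ (by simp) (by simp [hab.symm, hbv]) hE', Pp_edge' _ hE0 _ _ _ (by simp) (by simp) hab hE',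
    Finset.insert_comm b a, ← hA, ← hB, cnt_insert hE']
  have key : ∀ x : Sym2 V → K, (∑ t : K, if aeval (Function.update x s(a, b) t) (X s(a, b) * A + B) = 0 ∧
      aeval (Function.update x s(a, b) t) (X s(a, b) * B) = 0 then 1 else 0) + (if aeval x A = 0 ∧ aeval x B = 0 then 1 else 0) =
      (if aeval x B = 0 then 1 else 0) + Fintype.card K * (if aeval x A = 0 ∧ aeval x B = 0 then 1 else 0) := by
    intro x
    have hag : ∀ t : K, ∀ e ∈ E', Function.update x s(a, b) t e = x e := by
      intro t e he
      rw [Function.update_of_ne]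
      rintro rfl; exact hE' he
    have e1 : ∀ t, aeval (Function.update x s(a, b) t) A = aeval x A := fun t => Pp_congr _ _ _ _ (hag t)
    have e2 : ∀ t, aeval (Function.update x s(a, b) t) B = aeval x B := fun t => Pp_congr _ _ _ _ (hag t)
    simp only [map_add, map_mul, aeval_X, e1, e2, Function.update_self]
    by_cases hb0 : aeval x B = 0
    · by_cases ha0 : aeval x A = 0
      · simp [ha0, hb0]; ring
      · simp [ha0, hb0]
    · have : ∀ t : K, ¬ (t * aeval x A + aeval x B = 0 ∧ t * aeval x B = 0) := by
        rintro t ⟨h1, h2⟩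
        rcases mul_eq_zero.1 h2 with h | h
        · rw [h, zero_mul, zero_add] at h1; exact hb0 h1
        · exact hb0 h
      simp only [this, if_false, hb0, and_false, Finset.sum_const_zero, mul_zero]
  have s := Finset.sum_congr (rfl : SS K E' = SS K E') (fun x _ => key x)
  rw [Finset.sum_add_distrib, Finset.sum_add_distrib, ← Finset.mul_sum, ← cnt_eq_sum, ← cnt_eq_sum] at s
  have s' := congrArg (Nat.cast (R := K)) s
  rw [Nat.cast_add, Nat.cast_add, Nat.cast_mul, c1, c2] at s'
  simpa using s'

theorem step3_nadj3 {E : Finset (Sym2 V)} (hE : ∀ e ∈ E, ¬ e.IsDiag) {v a b c : V} (hI : Iso E {v})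
    (hav : a ≠ v) (hbv : b ≠ v) (hcv : c ≠ v) (hab : a ≠ b) (hac : a ≠ c) (hbc : b ≠ c)
    (hcard : 2 ≤ E.card)
    (hadj : s(a, b) ∉ E) (hd : (E.filter (fun e => c ∈ e)).card = 3) :
    ((cnt E (fun x : Sym2 V → K => aeval x (Pp E (insert a {v})) = 0 ∧ aeval x (Pp E (insert a (insert b {v}))) = 0) : ℕ) : K) = 0 := by
  obtain ⟨d1, d2, d3, h12, h13, h23, h1c, h2c, h3c, h1v, h2v, h3v, hEE⟩ := star3 hE hI hd
  set E0 := E.filter (fun e => c ∉ e) with hE0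
  have hnd : ∀ e ∈ E0, ¬ e.IsDiag := fun e he => hE e (Finset.mem_filter.1 he).1
  have hI0 : Iso E0 (insert c {v}) := by
    intro e he r hr
    rw [hE0, Finset.mem_filter] at he
    rcases Finset.mem_insert.1 hr with rfl | hr
    · exact he.2
    · exact hI e he.1 r hr
  have hI1 : Iso (insert s(a, b) E0) (insert c {v}) := by
    intro e he r hr
    rcases Finset.mem_insert.1 he with rfl | he
    · simp only [Finset.mem_insert, Finset.mem_singleton] at hr
      rw [Sym2.mem_iff]
      rcases hr with rfl | rfl <;> tauto
    · exact hI0 e he r hr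
  have hIv : Iso (insert s(a, b) E) {v} := by
    intro e he r hr
    rcases Finset.mem_insert.1 he with rfl | he
    · simp only [Finset.mem_singleton] at hr
      subst hr
      rw [Sym2.mem_iff]
      tauto
    · exact hI e he r hr
  have D1 := ML_dvd (K := K) hnd (Finset.mem_insert_self c {v}) (a := d1) (b := d2) (c := d3)
    (by simp [h1c, h1v]) (by simp [h2c, h2v]) (by simp [h3c, h3v]) h12 h13 h23 hI0
  have D2 := ML_dvd (K := K) (nd_insert hnd hab) (Finset.mem_insert_self c {v}) (a := d1) (b := d2) (c := d3)
    (by simp [h1c, h1v]) (by simp [h2c, h2v]) (by simp [h3c, h3v]) h12 h13 h23 hI1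
  rw [← hEE, ← hI.Pp_swap (by simpa using hav) (by simpa using hcv)] at D1
  rw [Finset.insert_comm _ s(a, b), Finset.insert_comm _ s(a, b), Finset.insert_comm _ s(a, b), ← hEE,
    ← hIv.Pp_swap (a := a) (by simpa using hav) (by simpa using hcv),
    Pp_edge _ hE _ _ _ (by simp) (by simp [hab.symm, hbv]) hadj, Finset.insert_comm b a, cnt_insert hadj] at D2
  set f := Pp E (insert a {v}) with hf
  set g := Pp E (insert a (insert b {v})) with hg
  have key : ∀ x : Sym2 V → K, (∑ t : K, if aeval (Function.update x s(a, b) t) (X s(a, b) * f + g) = 0 then 1 else 0)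
      + (if aeval x f = 0 then 1 else 0) = 1 + Fintype.card K * (if aeval x f = 0 ∧ aeval x g = 0 then 1 else 0) := by
    intro x
    have hag : ∀ t : K, ∀ e ∈ E, Function.update x s(a, b) t e = x e := by
      intro t e he
      rw [Function.update_of_ne]
      rintro rfl; exact hadj he
    have e1 : ∀ t, aeval (Function.update x s(a, b) t) f = aeval x f := fun t => Pp_congr _ _ _ _ (hag t)
    have e2 : ∀ t, aeval (Function.update x s(a, b) t) g = aeval x g := fun t => Pp_congr _ _ _ _ (hag t)
    simp only [map_add, map_mul, aeval_X, e1, e2, Function.update_self, lin_count]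
    by_cases hb0 : aeval x g = 0 <;> by_cases ha0 : aeval x f = 0 <;> simp [ha0, hb0]; ring
  have s := Finset.sum_congr (rfl : SS K E = SS K E) (fun x _ => key x)
  rw [Finset.sum_add_distrib, Finset.sum_add_distrib, ← Finset.mul_sum, ← cnt_eq_sum, ← cnt_eq_sum] at s
  simp only [Finset.sum_const, smul_eq_mul, mul_one, card_SS] at s
  have D3 := dvd_add D2 D1
  rw [s, Nat.dvd_add_right (pow_dvd_pow _ hcard), sq] at D3
  have D4 := Nat.dvd_of_mul_dvd_mul_left Fintype.card_pos D3
  obtain ⟨k, hk⟩ := D4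
  rw [hk, Nat.cast_mul]
  simp

theorem step3_nadj2 {E : Finset (Sym2 V)} (hE : ∀ e ∈ E, ¬ e.IsDiag) {v a b c : V} (hI : Iso E {v})
    (hav : a ≠ v) (hbv : b ≠ v) (hcv : c ≠ v) (hab : a ≠ b) (hac : a ≠ c) (hbc : b ≠ c)
    (hadj : s(a, b) ∉ E) (hd : (E.filter (fun e => c ∈ e)).card = 2) :
    ((cnt E (fun x : Sym2 V → K => aeval x (Pp E (insert a {v})) = 0 ∧ aeval x (Pp E (insert a (insert b {v}))) = 0) : ℕ) : K) = 0 := by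
  obtain ⟨d1, d2, h12, h1c, h2c, h1v, h2v, hEE⟩ := star2 hE hI hd
  set E0 := E.filter (fun e => c ∉ e) with hE0
  have hnd : ∀ e ∈ E0, ¬ e.IsDiag := fun e he => hE e (Finset.mem_filter.1 he).1
  have hI0 : Iso E0 (insert c {v}) := by
    intro e he r hr
    rw [hE0, Finset.mem_filter] at he
    rcases Finset.mem_insert.1 hr with rfl | hr
    · exact he.2
    · exact hI e he.1 r hr
  have hI1 : Iso (insert s(a, b) E0) (insert c {v}) := by
    intro e he r hr
    rcases Finset.mem_insert.1 he with rfl | he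
    · simp only [Finset.mem_insert, Finset.mem_singleton] at hr
      rw [Sym2.mem_iff]
      rcases hr with rfl | rfl <;> tauto
    · exact hI0 e he r hr
  have hIv : Iso (insert s(a, b) E) {v} := by
    intro e he r hr
    rcases Finset.mem_insert.1 he with rfl | he
    · simp only [Finset.mem_singleton] at hr
      subst hr
      rw [Sym2.mem_iff]
      tauto
    · exact hI e he r hr
  have n0 : ∀ d, s(c, d) ∉ E0 := fun d h => hI0 _ h c (by simp) (Sym2.mem_mk_left _ _)
  have n1 : ∀ d, s(c, d) ∉ insert s(a, b) E0 := fun d h => hI1 _ h c (by simp) (Sym2.mem_mk_left _ _)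
  have hd1 : d1 ∉ (insert c {v} : Finset V) := by simp [h1c, h1v]
  have hd2 : d2 ∉ (insert c {v} : Finset V) := by simp [h2c, h2v]
  have X1 := expand2 hnd (Finset.mem_insert_self c {v}) hd1 hd2 h12 (n0 _) (n0 _)
  have X2 := expand2 (nd_insert hnd hab) (Finset.mem_insert_self c {v}) hd1 hd2 h12 (n1 _) (n1 _)
  rw [← hEE, ← hI.Pp_swap (by simpa using hav) (by simpa using hcv), hI0.Pp_zero hd1, hI0.Pp_swap hd1 hd2] at X1
  rw [Finset.insert_comm _ s(a, b), Finset.insert_comm _ s(a, b), ← hEE,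
    ← hIv.Pp_swap (a := a) (by simpa using hav) (by simpa using hcv),
    Pp_edge _ hE _ _ _ (by simp) (by simp [hab.symm, hbv]) hadj, Finset.insert_comm b a, hI1.Pp_zero hd1, hI1.Pp_swap hd1 hd2] at X2
  set f := Pp E (insert a {v}) with hf
  set g := Pp E (insert a (insert b {v})) with hg
  have m1 : s(c, d1) ≠ s(c, d2) := by rw [ne_eq, Sym2.eq_iff]; tauto
  have hab0 : s(a, b) ∉ E0 := fun h => hadj (Finset.mem_filter.1 h).1
  have q1 : ∀ d, s(a, b) ≠ s(c, d) := by intro d h; rw [Sym2.eq_iff] at h; tauto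
  rw [hEE, cnt_insert (by simp [m1, n0]), sum_SS_insert (n0 _)]
  have key : ∀ x ∈ SS K E0, (∑ t2 : K, ∑ t1 : K,
      if aeval (Function.update (Function.update x s(c, d2) t2) s(c, d1) t1) f = 0 ∧
        aeval (Function.update (Function.update x s(c, d2) t2) s(c, d1) t1) g = 0 then 1 else 0) =
      Fintype.card K * ∑ t : K, if t * aeval x (Pp E0 (insert d2 (insert c {v}))) + aeval x (Pp E0 (insert d2 (insert d1 (insert c {v})))) = 0
        ∧ t * aeval x (Pp (insert s(a, b) E0) (insert d2 (insert c {v}))) + aeval x (Pp (insert s(a, b) E0) (insert d2 (insert d1 (insert c {v})))) = 0 then 1 else 0 := by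
    intro x hx
    rw [← smul_eq_mul, ← Finset.card_univ, ← Finset.sum_const]
    apply Finset.sum_congr rfl; intro t2 _
    conv_rhs => rw [← Equiv.sum_comp (Equiv.addRight t2)]
    apply Finset.sum_congr rfl; intro t1 _
    have hag : ∀ e ∈ insert s(a, b) E0, Function.update (Function.update x s(c, d2) t2) s(c, d1) t1 e = x e := by
      intro e he
      have hn : ∀ y, e ≠ s(c, y) := fun y h => n1 y (h ▸ he)
      simp [Function.update_of_ne (hn _)]
    have hag0 : ∀ e ∈ E0, Function.update (Function.update x s(c, d2) t2) s(c, d1) t1 e = x e :=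
      fun e he => hag e (Finset.mem_insert_of_mem he)
    have Y1 := congrArg (aeval (Function.update (Function.update x s(c, d2) t2) s(c, d1) t1)) X1
    have Y2 := congrArg (aeval (Function.update (Function.update x s(c, d2) t2) s(c, d1) t1)) X2
    simp only [map_add, map_mul, aeval_X, map_zero, Pp_congr _ _ _ _ hag, Pp_congr _ _ _ _ hag0, hag s(a, b) (by simp),
      mem_SS.1 hx _ hab0, Function.update_self, Function.update_of_ne m1.symm] at Y1 Y2
    congr 1
    rw [Equiv.coe_addRight]
    apply propext
    apply and_congr
    · rw [Y1]; constructor <;> intro h <;> linear_combination h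
    · have : ∀ z : K, z = 0 * aeval (Function.update (Function.update x s(c, d2) t2) s(c, d1) t1) f + z := by intro z; ring
      rw [this (aeval _ g), Y2]; constructor <;> intro h <;> linear_combination h
  rw [Finset.sum_congr rfl key, ← Finset.mul_sum, Nat.cast_mul]
  simp

theorem step3 {E : Finset (Sym2 V)} (hE : ∀ e ∈ E, ¬ e.IsDiag) {v a b c : V} (hI : Iso E {v})
    (hav : a ≠ v) (hbv : b ≠ v) (hcv : c ≠ v) (hab : a ≠ b) (hac : a ≠ c) (hbc : b ≠ c)
    (hcard : E.card + 5 = 2 * Fintype.card V) (hn : 4 ≤ Fintype.card V)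
    (hd : (E.filter (fun e => c ∈ e)).card = 2 ∨ (E.filter (fun e => c ∈ e)).card = 3) :
    ((cnt E (fun x : Sym2 V → K => aeval x (Pp E (insert a {v})) = 0 ∧ aeval x (Pp E (insert a (insert b {v}))) = 0) : ℕ) : K) = 0 := by
  by_cases hadj : s(a, b) ∈ E
  · exact step3_adj hE hav hbv hab hcard hn hadj
  · rcases hd with hd | hd
    · exact step3_nadj2 hE hI hav hbv hcv hab hac hbc hadj hd
    · exact step3_nadj3 hE hI hav hbv hcv hab hac hbc (by omega) hadj hd

end PartF

section PartG
variable {K : Type} [Field K] [Fintype K] [DecidableEq K]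
variable {V : Type} [Fintype V] [DecidableEq V]

set_option maxHeartbeats 1000000 in
theorem core {E : Finset (Sym2 V)} (hE : ∀ e ∈ E, ¬ e.IsDiag) {v a b c : V} (hI : Iso E {v})
    (hav : a ≠ v) (hbv : b ≠ v) (hcv : c ≠ v) (hab : a ≠ b) (hac : a ≠ c) (hbc : b ≠ c)
    (hcard : E.card + 5 = 2 * Fintype.card V) (hn : 4 ≤ Fintype.card V)
    (hdc : (E.filter (fun e => c ∈ e)).card = 2 ∨ (E.filter (fun e => c ∈ e)).card = 3)
    (hda : (E.filter (fun e => a ∈ e)).card = 2 ∨ (E.filter (fun e => a ∈ e)).card = 3) :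
    ((cnt (insert s(v, a) (insert s(v, b) (insert s(v, c) E)))
      (fun x : Sym2 V → K => aeval x (Pp (insert s(v, a) (insert s(v, b) (insert s(v, c) E))) {v}) = 0)
      / Fintype.card K ^ 2 : ℕ) : K) =
    - ((((Pp E (insert a {v}) * Ph E {v} b a c) ^ (Fintype.card K - 1)).coeff (dE E (Fintype.card K - 1)) : ℤ) : K) := by
  have ha : a ∉ ({v} : Finset V) := by simpa using hav
  have hb : b ∉ ({v} : Finset V) := by simpa using hbv
  have hc : c ∉ ({v} : Finset V) := by simpa using hcv
  have hq0 : 0 < Fintype.card K := Fintype.card_pos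
  have M := ML (K := K) hE (Finset.mem_singleton_self v) ha hb hc hab hac hbc hI
  have MD := ML_dvd (K := K) hE (Finset.mem_singleton_self v) ha hb hc hab hac hbc hI
  have S1 := step3 (K := K) hE hI hav hbv hcv hab hac hbc hcard hn hdc
  have S2 := step3 (K := K) hE hI hbv hcv hav hbc hab.symm hac.symm hcard hn hda
  rw [← hI.Pp_swap ha hb] at S2
  have s1 := Pp_split (a := a) (b := b) hI hab hc
  have s3 := Pp_split (a := b) (b := c) hI hbc ha
  rw [← Ph_symm hI hab.symm hbc ha hc, ← Ph_symm hI hac.symm hbc.symm ha hb] at s3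
  rw [s1] at S1
  rw [s3] at S2
  have hquad := Pp_quad hE hI ha hb hc hab hac hbc
  have d0 : (Pp E (insert a {v})).totalDegree ≤ E.card - (Fintype.card V - 2) := by
    have := Pp_totalDegree hE (insert a {v})
    rwa [Finset.card_insert_of_notMem ha, Finset.card_singleton] at this
  have d2 : (Ph E {v} b a c).totalDegree ≤ E.card - (Fintype.card V - 3) := by
    have := Ph_totalDegree hE {v} b a c hab.symm hb ha
    rwa [Finset.card_singleton] at this
  set f0 := Pp E (insert a {v})
  set f1 := Ph E {v} a b c
  set f2 := Ph E {v} b a c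
  set f3 := Ph E {v} c a b
  set h := Pp E (insert a (insert b (insert c {v})))
  have C0 := CW1 (K := K) E f0 (by omega)
  have C2 := CW1 (K := K) E f2 (by omega)
  have C3 := CW3 (K := K) E (f0 * f2) ((MvPolynomial.totalDegree_mul _ _).trans (by omega)) (by omega)
  have hodd : Odd E.card := by rw [Nat.odd_iff]; omega
  rw [hodd.neg_one_pow, neg_mul, one_mul, neg_neg] at C3
  rw [← C3]
  have hq : ∀ x : Sym2 V → K, aeval x f0 * aeval x h = aeval x f1 * aeval x f2 + aeval x f1 * aeval x f3 + aeval x f2 * aeval x f3 := by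
    intro x
    have := congrArg (aeval x) hquad
    simpa only [map_mul, map_add] using this
  have I1 : cnt E (fun x : Sym2 V → K => aeval x (f0 * f2) = 0) + cnt E (fun x : Sym2 V → K => aeval x f0 = 0 ∧ aeval x f2 = 0) =
      cnt E (fun x : Sym2 V → K => aeval x f0 = 0) + cnt E (fun x : Sym2 V → K => aeval x f2 = 0) := by
    simp only [cnt_eq_sum, ← Finset.sum_add_distrib]
    apply Finset.sum_congr rfl
    intro x _
    rw [map_mul]
    by_cases h1 : aeval x f0 = 0 <;> by_cases h2 : aeval x f2 = 0 <;> simp [h1, h2]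
  have I2 : cnt E (fun x : Sym2 V → K => aeval x f0 = 0 ∧ aeval x f2 = 0) +
      cnt E (fun x : Sym2 V → K => aeval x f0 = 0 ∧ aeval x f1 = 0 ∧ aeval x f2 = 0 ∧ aeval x f3 = 0) =
      cnt E (fun x : Sym2 V → K => aeval x f0 = 0 ∧ aeval x (f1 + f2) = 0) + cnt E (fun x : Sym2 V → K => aeval x f0 = 0 ∧ aeval x (f2 + f3) = 0) := by
    simp only [cnt_eq_sum, ← Finset.sum_add_distrib]
    apply Finset.sum_congr rfl
    intro x _
    rw [map_add, map_add]
    have hx := hq x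
    by_cases h0 : aeval x f0 = 0
    · rw [h0, zero_mul] at hx
      have z1 : aeval x f1 + aeval x f2 = 0 ↔ aeval x f1 = 0 ∧ aeval x f2 = 0 := by
        constructor
        · intro hs
          have e2 : aeval x f2 = - aeval x f1 := by linear_combination hs
          have : (aeval x f1) ^ 2 = 0 := by linear_combination hx + (aeval x f1 + aeval x f3) * hs
          have g1 := pow_eq_zero_iff (two_ne_zero) |>.1 this
          exact ⟨g1, by rw [e2, g1, neg_zero]⟩
        · rintro ⟨g1, g2⟩; rw [g1, g2, add_zero]
      have z2 : aeval x f2 + aeval x f3 = 0 ↔ aeval x f2 = 0 ∧ aeval x f3 = 0 := by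
        constructor
        · intro hs
          have e2 : aeval x f3 = - aeval x f2 := by linear_combination hs
          have : (aeval x f2) ^ 2 = 0 := by linear_combination hx + (aeval x f1 + aeval x f2) * hs
          have g1 := pow_eq_zero_iff (two_ne_zero) |>.1 this
          exact ⟨g1, by rw [e2, g1, neg_zero]⟩
        · rintro ⟨g1, g2⟩; rw [g1, g2, add_zero]
      simp only [z1, z2]
      by_cases h2 : aeval x f2 = 0
      · rw [h2] at hx
        have : aeval x f1 = 0 ∨ aeval x f3 = 0 := by
          apply mul_eq_zero.1; linear_combination -hx
        clear_value f0 f1 f2 f3 h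
        rcases this with h1 | h3
        · by_cases h3 : aeval x f3 = 0 <;> simp [h0, h1, h2, h3]
        · by_cases h1 : aeval x f1 = 0 <;> simp [h0, h1, h2, h3]
      · simp [h2]
    · simp [h0]
  obtain ⟨k, hk⟩ := MD
  rw [hk] at M ⊢
  rw [Nat.mul_div_cancel_left _ (by positivity)]
  have M2 : k + cnt E (fun x : Sym2 V → K => aeval x f0 = 0 ∧ aeval x f1 = 0 ∧ aeval x f2 = 0 ∧ aeval x f3 = 0) =
      Fintype.card K ^ E.card + Fintype.card K * cnt E (fun x : Sym2 V → K => (aeval x f0 = 0 ∧ aeval x f1 = 0 ∧ aeval x f2 = 0 ∧ aeval x f3 = 0) ∧ aeval x h = 0) := by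
    have : Fintype.card K ^ 2 ≠ 0 := by positivity
    apply Nat.eq_of_mul_eq_mul_left (Nat.pos_of_ne_zero this)
    rw [mul_add, mul_add, M]
    ring
  have J1 := congrArg (Nat.cast (R := K)) I1
  have J2 := congrArg (Nat.cast (R := K)) I2
  have J3 := congrArg (Nat.cast (R := K)) M2
  rw [Nat.cast_add, Nat.cast_add] at J1 J2
  rw [Nat.cast_add, Nat.cast_add, Nat.cast_pow, Nat.cast_mul, card_cast_zero, zero_pow (by omega)] at J3
  rw [C0, C2] at J1
  rw [S1, S2] at J2
  linear_combination J3 + J1 - J2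

end PartG

section PartH
variable {V : Type} [Fintype V] [DecidableEq V]

theorem rename_prod (E T : Finset (Sym2 V)) (D : DecidablePred (fun e : ↥E => (e : Sym2 V) ∉ (T : Set (Sym2 V)))) :
    rename (Subtype.val : ↥E → Sym2 V) (∏ e ∈ Finset.univ.filter (fun e : ↥E => (e : Sym2 V) ∉ (T : Set (Sym2 V))), (X e : MvPolynomial ↥E ℤ))
     = ∏ e ∈ E \ T, X e := by
  classical
  rw [map_prod]
  simp only [rename_X]
  have : E \ T = (Finset.univ.filter (fun e : ↥E => (e : Sym2 V) ∉ (T : Set (Sym2 V)))).map (Function.Embedding.subtype _) := by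
    ext e
    simp [and_comm]
  rw [this, Finset.prod_map]
  rfl

theorem sum_coe {α M : Type} [AddCommMonoid M] (s : Finset (Finset α)) (S : Finset (Set α))
    (hS : ∀ x, x ∈ S ↔ ∃ a ∈ s, (a : Set α) = x) (f : Set α → M) (P : Set α → Prop) (Q : Finset α → Prop)
    (D : DecidablePred P) (D' : DecidablePred Q) (hPQ : ∀ a ∈ s, P (a : Set α) ↔ Q a) (g : Finset α → M)
    (hfg : ∀ a ∈ s, f (a : Set α) = g a) :
    ∑ x ∈ S.filter P, f x = ∑ a ∈ s.filter Q, g a := by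
  symm
  refine Finset.sum_bij (fun a _ => (a : Set α)) ?_ ?_ ?_ ?_
  · intro a ha
    rw [Finset.mem_filter] at ha ⊢
    exact ⟨(hS _).2 ⟨a, ha.1, rfl⟩, (hPQ a ha.1).2 ha.2⟩
  · intro a _ b _ h
    exact Finset.coe_injective h
  · intro x hx
    rw [Finset.mem_filter] at hx
    obtain ⟨a, ha, rfl⟩ := (hS _).1 hx.1
    exact ⟨a, Finset.mem_filter.2 ⟨ha, (hPQ a ha).1 hx.2⟩, rfl⟩
  · intro a ha
    rw [Finset.mem_filter] at ha
    exact (hfg a ha.1).symm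

theorem tree_rooted (T : Finset (Sym2 V)) (r : V) :
    (SimpleGraph.fromEdgeSet (T : Set (Sym2 V))).IsTree ↔ Rooted {r} T := by
  constructor
  · rintro ⟨h1, h2⟩
    refine ⟨h2, fun w => ⟨r, by simp, h1.preconnected w r⟩, ?_⟩
    intro a ha b hb _
    rw [Finset.mem_singleton] at ha hb
    rw [ha, hb]
  · rintro ⟨h1, h2, _⟩
    have hr : ∀ w, (SimpleGraph.fromEdgeSet (T : Set (Sym2 V))).Reachable w r := by
      intro w
      obtain ⟨r', hr', h⟩ := h2 w
      rw [Finset.mem_singleton] at hr'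
      exact hr' ▸ h
    have : Nonempty V := ⟨r⟩
    exact ⟨⟨fun x y => (hr x).trans (hr y).symm⟩, h1⟩

theorem rename_kirchhoff (G : SimpleGraph V) [DecidableRel G.Adj] (r : V) :
    rename Subtype.val (kirchhoff G) = Pp G.edgeFinset {r} := by
  classical
  unfold kirchhoff Pp
  rw [map_sum]
  apply sum_coe G.edgeFinset.powerset
  · intro x
    simp [eq_comm]
  · intro T _
    exact tree_rooted T r
  · intro T _
    convert rename_prod G.edgeFinset T _

theorem rename_forestPoly (G : SimpleGraph V) [DecidableRel G.Adj] (b a c : V) (hab : a ≠ b) :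
    rename Subtype.val (forestPoly G b a c) = Ph G.edgeFinset ∅ b a c := by
  classical
  unfold forestPoly Ph
  rw [map_sum]
  apply sum_coe G.edgeFinset.powerset
  · intro x
    simp [eq_comm]
  swap
  · intro T _
    convert rename_prod G.edgeFinset T _
  intro T _
  simp only [Rooted]
  constructor
  · rintro ⟨h1, h2, h3, h4⟩
    refine ⟨⟨h1, ?_, ?_⟩, h2⟩
    · intro w
      rcases h4 w with h | h
      · exact ⟨a, by simp, h⟩
      · exact ⟨b, by simp, h⟩
    · intro r hr r' hr' hre
      simp only [Finset.mem_insert, Finset.notMem_empty, or_false] at hr hr'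
      rcases hr with rfl | rfl <;> rcases hr' with rfl | rfl
      · rfl
      · exact absurd hre.symm h3
      · exact absurd hre h3
      · rfl
  · rintro ⟨⟨h1, h2, h3⟩, h4⟩
    refine ⟨h1, h4, ?_, ?_⟩
    · intro h
      exact hab (h3 a (by simp) b (by simp) h)
    · intro w
      obtain ⟨r, hr, h⟩ := h2 w
      simp only [Finset.mem_insert, Finset.notMem_empty, or_false] at hr
      rcases hr with rfl | rfl
      · exact Or.inr h
      · exact Or.inl h

theorem pointCount_eq (p s : ℕ) [Fact p.Prime] [Fintype (GaloisField p s)] [DecidableEq (GaloisField p s)]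
    {E : Finset (Sym2 V)} (F : MvPolynomial ↥E ℤ) :
    pointCount p s F = cnt E (fun y : Sym2 V → GaloisField p s => aeval y (rename Subtype.val F) = 0) := by
  unfold pointCount cnt
  rw [← Nat.card_eq_finsetCard]
  have hext : ∀ x : ↥E → GaloisField p s, (fun e : Sym2 V => if h : e ∈ E then x ⟨e, h⟩ else 0) ∘ (Subtype.val : ↥E → Sym2 V) = x := by
    intro x; funext e; simp
  refine Nat.card_congr ⟨fun x => ⟨fun e => if h : e ∈ E then x.1 ⟨e, h⟩ else 0, ?_⟩,
    fun y => ⟨y.1 ∘ Subtype.val, ?_⟩, ?_, ?_⟩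
  · rw [Finset.mem_filter, mem_SS, aeval_rename, hext]
    exact ⟨fun e he => by simp [he], x.2⟩
  · have := (Finset.mem_filter.1 y.2).2
    rwa [aeval_rename] at this
  · intro x
    apply Subtype.ext
    exact hext x.1
  · intro y
    apply Subtype.ext
    funext e
    have := mem_SS.1 (Finset.mem_filter.1 y.2).1 e
    by_cases he : e ∈ E
    · simp [he]
    · simp [he, this he]

theorem Dm_restrict {K : Type} [CommRing K] (A : Matrix V V K) (v : V) (S : Finset ↥{w : V | w ≠ v}) :
    Dm A (insert v (S.image Subtype.val)) = Dm (A.submatrix Subtype.val Subtype.val) S := by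
  unfold Dm
  rw [Matrix.twoBlockTriangular_det _ (fun w => w ∈ {w : V | w ≠ v})]
  · have h1 : (Rw A (insert v (S.image Subtype.val))).toSquareBlockProp (fun w => w ∈ {w : V | w ≠ v}) =
        Rw (A.submatrix Subtype.val Subtype.val) S := by
      ext i j
      have hi : (i : V) ≠ v := i.2
      simp [Matrix.toSquareBlockProp, Rw, hi, Subtype.ext_iff]
    have h2 : (Rw A (insert v (S.image Subtype.val))).toSquareBlockProp (fun w => ¬ w ∈ {w : V | w ≠ v}) = 1 := by
      ext i j
      have hi : (i : V) = v := by simpa using i.2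
      simp [Matrix.toSquareBlockProp, Rw, hi, Subtype.ext_iff, Matrix.one_apply]
    rw [h1, h2, Matrix.det_one, mul_one]
  · intro i hi j hj
    have hi : i = v := by simpa using hi
    have hj : j ≠ v := by simpa using hj
    subst hi
    simp [Rw, hj.symm]

def jm (v : V) : Sym2 ↥{w : V | w ≠ v} → Sym2 V := Sym2.map Subtype.val

theorem jm_inj (v : V) : Function.Injective (jm v) := Sym2.map.injective Subtype.val_injective

theorem v_notMem_jm (v : V) (e : Sym2 ↥{w : V | w ≠ v}) : v ∉ jm v e := by
  induction e using Sym2.ind with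
  | _ x y =>
    have hx : (x : V) ≠ v := x.2
    have hy : (y : V) ≠ v := y.2
    simp [jm, hx.symm, hy.symm]

theorem jm_iso (v : V) (E : Finset (Sym2 ↥{w : V | w ≠ v})) : Iso (E.image (jm v)) {v} := by
  intro e he r hr
  rw [Finset.mem_singleton] at hr
  subst hr
  obtain ⟨e', _, rfl⟩ := Finset.mem_image.1 he
  exact v_notMem_jm _ _

theorem jm_nd (v : V) (E : Finset (Sym2 ↥{w : V | w ≠ v})) (hE : ∀ e ∈ E, ¬ e.IsDiag) :
    ∀ e ∈ E.image (jm v), ¬ e.IsDiag := by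
  intro e he
  obtain ⟨e', h, rfl⟩ := Finset.mem_image.1 he
  have := hE e' h
  revert this
  induction e' using Sym2.ind with
  | _ x y => simp [jm, Subtype.ext_iff]

theorem rename_Pp (v : V) (E : Finset (Sym2 ↥{w : V | w ≠ v})) (hE : ∀ e ∈ E, ¬ e.IsDiag)
    (S : Finset ↥{w : V | w ≠ v}) :
    rename (jm v) (Pp E S) = Pp (E.image (jm v)) (insert v (S.image Subtype.val)) := by
  rw [← sub_eq_zero]
  apply transfer
  intro α hα
  rw [map_sub, aeval_rename, eval_Pp _ hE _ (α ∘ jm v) (fun e => hα _), eval_Pp _ (jm_nd v E hE) _ _ hα, Dm_restrict,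
    Finset.prod_image (fun x _ y _ h => jm_inj v h), sub_eq_zero]
  congr 2
  have hy : ∀ e, yE (E.image (jm v)) α (jm v e) = yE E (α ∘ jm v) e := by
    intro e
    simp [yE, (jm_inj v).eq_iff]
  have h0 : ∀ x, yE (E.image (jm v)) α s(x, v) = 0 := by
    intro x
    unfold yE
    rw [if_neg]
    intro h
    exact jm_iso v E _ h v (by simp) (Sym2.mem_mk_right _ _)
  ext i j
  have e1 : ∀ x : ↥{w : V | w ≠ v}, yE (E.image (jm v)) α s((i : V), (x : V)) = yE E (α ∘ jm v) s(i, x) := fun x => hy s(i, x)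
  simp only [lap, Matrix.of_apply, Matrix.submatrix_apply, e1, Subtype.ext_iff]
  congr 1
  apply if_congr Iff.rfl _ rfl
  rw [← Finset.sum_congr rfl (fun x _ => e1 x)]
  rw [← Finset.sum_erase (Finset.univ : Finset V) (h0 i)]
  symm
  apply Finset.sum_subtype
  simp

theorem Ph_two {E : Finset (Sym2 V)} {R : Finset V} (h : Iso E R) {a b c : V}
    (ha : a ∉ R) (hb : b ∉ R) (hc : c ∉ R) (hab : a ≠ b) (hac : a ≠ c) (hbc : b ≠ c) :
    2 * Ph E R b a c = Pp E (insert a (insert b R)) + Pp E (insert b (insert c R)) - Pp E (insert a (insert c R)) := by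
  have s1 := Pp_split (a := a) (b := b) h hab hc
  have s2 := Pp_split (a := a) (b := c) h hac hb
  have s3 := Pp_split (a := b) (b := c) h hbc ha
  rw [← Ph_symm h hab hac hb hc] at s2
  rw [← Ph_symm h hab.symm hbc ha hc, ← Ph_symm h hac.symm hbc.symm ha hb] at s3
  rw [s1, s2, s3]; ring

theorem rename_Ph (v : V) (E : Finset (Sym2 ↥{w : V | w ≠ v})) (hE : ∀ e ∈ E, ¬ e.IsDiag)
    (a b c : ↥{w : V | w ≠ v}) (hab : a ≠ b) (hac : a ≠ c) (hbc : b ≠ c) :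
    rename (jm v) (Ph E ∅ b a c) = Ph (E.image (jm v)) {v} b a c := by
  have hv : ∀ x : ↥{w : V | w ≠ v}, (x : V) ∉ ({v} : Finset V) := by
    intro x
    have : (x : V) ≠ v := x.2
    simpa using this
  have h2 : (2 : MvPolynomial (Sym2 V) ℤ) ≠ 0 := by
    exact two_ne_zero
  apply mul_left_cancel₀ h2
  have t1 := congrArg (rename (jm v)) (Ph_two (E := E) (R := ∅) (fun e _ r hr => by simp at hr) (by simp) (by simp) (by simp) hab hac hbc)
  rw [Ph_two (jm_iso v E) (hv a) (hv b) (hv c) (Subtype.val_injective.ne hab) (Subtype.val_injective.ne hac) (Subtype.val_injective.ne hbc)]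
  rw [map_mul, map_sub, map_add, rename_Pp _ _ hE, rename_Pp _ _ hE, rename_Pp _ _ hE, map_ofNat] at t1
  rw [t1]
  have e : ∀ x y : ↥{w : V | w ≠ v}, insert v ((insert x (insert y ∅) : Finset ↥{w : V | w ≠ v}).image Subtype.val) = insert (x : V) (insert (y : V) {v}) := by
    intro x y
    ext z
    simp only [Finset.mem_insert, Finset.mem_image, Finset.mem_singleton, Finset.notMem_empty, or_false, exists_eq_or_imp, exists_eq_left]
    tauto
  rw [e, e, e]

end PartH

section PartI
variable {V : Type} [Fintype V] [DecidableEq V]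

theorem image_induce (G : SimpleGraph V) [DecidableRel G.Adj] (v : V) :
    (G.induce {w : V | w ≠ v}).edgeFinset.image (jm v) = G.edgeFinset.filter (fun e => v ∉ e) := by
  ext e
  simp only [Finset.mem_image, Finset.mem_filter, SimpleGraph.mem_edgeFinset]
  constructor
  · rintro ⟨e', he', rfl⟩
    refine ⟨?_, v_notMem_jm v e'⟩
    induction e' using Sym2.ind with
    | _ x y => simpa [jm] using he'
  · rintro ⟨h1, h2⟩
    induction e using Sym2.ind with
    | _ x y =>
      simp only [Sym2.mem_iff, not_or] at h2
      refine ⟨s(⟨x, fun h => h2.1 h.symm⟩, ⟨y, fun h => h2.2 h.symm⟩), ?_, by simp [jm]⟩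
      simpa using h1

theorem filter_mem_card (G : SimpleGraph V) [DecidableRel G.Adj] (w : V) :
    (G.edgeFinset.filter (fun e => w ∈ e)).card = G.degree w := by
  rw [← SimpleGraph.card_incidenceFinset_eq_degree, SimpleGraph.incidenceFinset_eq_filter]

theorem edge_split (G : SimpleGraph V) [DecidableRel G.Adj] {v a b c : V}
    (hva : G.Adj v a) (hvb : G.Adj v b) (hvc : G.Adj v c)
    (hab : a ≠ b) (hac : a ≠ c) (hbc : b ≠ c)
    (hdeg : G.degree v = 3) :
    G.edgeFinset = insert s(v,a) (insert s(v,b) (insert s(v,c) (G.edgeFinset.filter (fun e => v ∉ e)))) := by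
  have h1 : ({s(v,a), s(v,b), s(v,c)} : Finset (Sym2 V)) = G.edgeFinset.filter (fun e => v ∈ e) := by
    apply Finset.eq_of_subset_of_card_le
    · intro e he
      simp only [Finset.mem_insert, Finset.mem_singleton] at he
      rcases he with rfl | rfl | rfl <;> simp [*]
    · rw [filter_mem_card, hdeg, Finset.card_eq_three.2 ⟨s(v,a), s(v,b), s(v,c), ?_, ?_, ?_, rfl⟩]
      all_goals
        intro h
        rw [Sym2.congr_right] at h
        contradiction
  ext e
  have h2 := Finset.ext_iff.1 h1 e
  simp only [Finset.mem_insert, Finset.mem_singleton, Finset.mem_filter] at h2 ⊢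
  tauto

theorem filter_deg (G : SimpleGraph V) [DecidableRel G.Adj] {v c : V} (hvc : G.Adj v c) :
    ((G.edgeFinset.filter (fun e => v ∉ e)).filter (fun e => c ∈ e)).card + 1 = G.degree c := by
  rw [← filter_mem_card]
  have : G.edgeFinset.filter (fun e => c ∈ e) = insert s(v,c) ((G.edgeFinset.filter (fun e => v ∉ e)).filter (fun e => c ∈ e)) := by
    ext e
    simp only [Finset.mem_insert, Finset.mem_filter]
    constructor
    · rintro ⟨h1, h2⟩
      by_cases hv : v ∈ e
      · exact Or.inl ((Sym2.mem_and_mem_iff hvc.ne).1 ⟨hv, h2⟩)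
      · exact Or.inr ⟨⟨h1, hv⟩, h2⟩
    · rintro (rfl | h)
      · simp [hvc]
      · exact ⟨h.1.1, h.2⟩
  rw [this, Finset.card_insert_of_notMem]
  simp

theorem deg_facts (G : SimpleGraph V) [DecidableRel G.Adj] (hG : IsPrimitiveDivergent G) :
    (∀ w, G.degree w = 3 ∨ G.degree w = 4) ∧ G.edgeFinset.card + 2 = 2 * Fintype.card V := by
  classical
  obtain ⟨_, K, _, hK, _, hKG⟩ := hG
  have hd : ∀ w, K.degree w = 4 := by
    intro w
    rw [← hK w, Set.ncard_eq_toFinset_card', ← SimpleGraph.card_neighborFinset_eq_degree]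
    rfl
  have h1 : ∀ w, G.degree w + (if K.Adj (some w) none then 1 else 0) = 4 := by
    intro w
    rw [← hd (some w), ← SimpleGraph.card_neighborFinset_eq_degree, ← SimpleGraph.card_neighborFinset_eq_degree,
      SimpleGraph.neighborFinset_eq_filter, SimpleGraph.neighborFinset_eq_filter,
      Finset.card_filter, Finset.card_filter, Fintype.sum_option, add_comm]
    simp only [hKG]
  have h2 : ∑ w : V, (if K.Adj (some w) none then 1 else 0) = 4 := by
    rw [← hd none, ← SimpleGraph.card_neighborFinset_eq_degree,
      SimpleGraph.neighborFinset_eq_filter, Finset.card_filter, Fintype.sum_option]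
    simp [K.adj_comm none]
  refine ⟨fun w => ?_, ?_⟩
  · have := h1 w
    split_ifs at this <;> omega
  · have h3 := G.sum_degrees_eq_twice_card_edges
    have h4 := Finset.sum_congr rfl (fun w (_ : w ∈ (Finset.univ : Finset V)) => h1 w)
    rw [Finset.sum_add_distrib, h2, h3] at h4
    simp at h4
    omega

theorem mapDomain_dE (v : V) (E : Finset (Sym2 ↥{w : V | w ≠ v})) (k : ℕ) :
    Finsupp.mapDomain (jm v ∘ (Subtype.val : ↥E → _)) (Finsupp.equivFunOnFinite.symm fun _ => k) = dE (E.image (jm v)) k := by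
  have hinj : Function.Injective (jm v ∘ (Subtype.val : ↥E → _)) := (jm_inj v).comp Subtype.val_injective
  ext e
  by_cases he : e ∈ E.image (jm v)
  · obtain ⟨e', he', rfl⟩ := Finset.mem_image.1 he
    have : jm v e' = (jm v ∘ (Subtype.val : ↥E → _)) ⟨e', he'⟩ := rfl
    rw [this, Finsupp.mapDomain_apply hinj, ← this]
    simp only [dE, Finsupp.equivFunOnFinite_symm_apply_apply, if_pos he]
  · rw [Finsupp.mapDomain_of_notMem_range]
    · simp only [dE, Finsupp.equivFunOnFinite_symm_apply_apply, if_neg he]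
    · rintro ⟨x, rfl⟩
      exact he (Finset.mem_image_of_mem _ x.2)

theorem coeff_eq (G : SimpleGraph V) [DecidableRel G.Adj] (v : V) (a b c : ↥{w : V | w ≠ v})
    (hab : a ≠ b) (hac : a ≠ c) (hbc : b ≠ c) (k : ℕ) :
    ((kirchhoff (G.induce {w : V | w ≠ v}) * forestPoly (G.induce {w : V | w ≠ v}) b a c) ^ k).coeff
            (Finsupp.equivFunOnFinite.symm fun _ => k)
    = ((Pp (G.edgeFinset.filter (fun e => v ∉ e)) (insert a.1 {v}) * Ph (G.edgeFinset.filter (fun e => v ∉ e)) {v} b a c) ^ k).coeff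
      (dE (G.edgeFinset.filter (fun e => v ∉ e)) k) := by
  have hinj : Function.Injective (jm v ∘ (Subtype.val : ↥((G.induce {w : V | w ≠ v}).edgeFinset) → _)) :=
    (jm_inj v).comp Subtype.val_injective
  have hE : ∀ e ∈ (G.induce {w : V | w ≠ v}).edgeFinset, ¬ e.IsDiag := fun e he =>
    SimpleGraph.not_isDiag_of_mem_edgeFinset he
  rw [← coeff_rename_mapDomain _ hinj, mapDomain_dE, image_induce, ← rename_rename, map_pow, map_mul,
    rename_kirchhoff _ a, rename_forestPoly _ _ _ _ hab, map_pow, map_mul, rename_Pp v _ hE, rename_Ph v _ hE a b c hab hac hbc,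
    image_induce, Finset.image_singleton, Finset.pair_comm]

end PartI

theorem statement12 {V : Type} [Fintype V] [DecidableEq V]
    (G : SimpleGraph V) [DecidableRel G.Adj]
    (hG : IsPrimitiveDivergent G)
    (v a b c : V)
    (hva : G.Adj v a) (hvb : G.Adj v b) (hvc : G.Adj v c)
    (hab : a ≠ b) (hac : a ≠ c) (hbc : b ≠ c)
    (hdeg : G.degree v = 3)
    (e1 e2 e3 : ↥G.edgeFinset)
    (he1 : (e1 : Sym2 V) = s(v, a)) (he2 : (e2 : Sym2 V) = s(v, b))
    (he3 : (e3 : Sym2 V) = s(v, c))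
    (p s : ℕ) [Fact p.Prime] (hs : 1 ≤ s)
    (hdiv : (p ^ s) ^ 2 ∣ pointCount p s (kirchhoff G)) :
    ((pointCount p s (kirchhoff G) / (p ^ s) ^ 2 : ℕ) : ZMod p)
      = - ((((kirchhoff (G.induce {w : V | w ≠ v}) *
              forestPoly (G.induce {w : V | w ≠ v})
                ⟨b, hvb.ne'⟩ ⟨a, hva.ne'⟩ ⟨c, hvc.ne'⟩) ^ (p ^ s - 1)).coeff
            (Finsupp.equivFunOnFinite.symm fun _ => p ^ s - 1) : ℤ) : ZMod p) := by
  classical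
  letI : Fintype (GaloisField p s) := Fintype.ofFinite _
  have hq : Fintype.card (GaloisField p s) = p ^ s := by
    rw [← Nat.card_eq_fintype_card]
    exact GaloisField.card p s (by omega)
  apply (algebraMap (ZMod p) (GaloisField p s)).injective
  rw [map_neg, map_natCast, map_intCast,
    coeff_eq G v ⟨a, hva.ne'⟩ ⟨b, hvb.ne'⟩ ⟨c, hvc.ne'⟩ (by simpa using hab) (by simpa using hac) (by simpa using hbc)]
  obtain ⟨hd, hc⟩ := deg_facts G hG
  have hsp := edge_split G hva hvb hvc hab hac hbc hdeg
  have hfa := filter_deg G hva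
  have hfc := filter_deg G hvc
  have hE : ∀ e ∈ G.edgeFinset.filter (fun e => v ∉ e), ¬ e.IsDiag := fun e he =>
    SimpleGraph.not_isDiag_of_mem_edgeFinset (Finset.mem_filter.1 he).1
  have hI : Iso (G.edgeFinset.filter (fun e => v ∉ e)) {v} := by
    intro e he r hr
    rw [Finset.mem_singleton] at hr
    subst hr
    exact (Finset.mem_filter.1 he).2
  have hcard : (G.edgeFinset.filter (fun e => v ∉ e)).card + 5 = 2 * Fintype.card V := by
    have h1 := filter_mem_card G v
    have h2 := Finset.card_filter_add_card_filter_not (s := G.edgeFinset) (fun e => v ∈ e)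
    omega
  have hn : 4 ≤ Fintype.card V := by
    have : ({v, a, b, c} : Finset V).card = 4 := by
      simp [hva.ne, hvb.ne, hvc.ne, hab, hac, hbc]
    rw [← this]
    exact Finset.card_le_univ _
  have key := core (K := GaloisField p s) hE hI hva.ne' hvb.ne' hvc.ne' hab hac hbc hcard hn
    (by have := hd c; omega) (by have := hd a; omega)
  rw [← hsp, hq] at key
  rw [pointCount_eq, rename_kirchhoff G v]
  exact key
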